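/- arXiv:2104.06948 — 2 statements merged into one kernel-verified Lean document; each statement's English description precedes it below -/
import Mathlib

section
/- Under Condition (6), for every j ∈ ℕ and every a > 0, ∑_{r∈ℕ^j} e^{−a|t + log p_r|} ~ (2/(a log 2)) · (Φ_j(2e^t) − Φ_j(e^t)) as t → ∞ (i.e., the ratio of the two sides tends to 1). -/
open Filter Topology

/-- Product weight of a box `r` in generation `j`: `p_r = p_{r 0} ⋯ p_{r (j-1)}`. -/
noncomputable def prodP (p : ℕ → ℝ) (j : ℕ) (r : Fin j → ℕ) : ℝ := ∏ i, p (r i)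

/-- Counting function of generation `j`: `ρ_j(x) = #{r ∈ ℕ^j : p_r ≥ 1/x}` (as a real number). -/
noncomputable def rhoJ (p : ℕ → ℝ) (j : ℕ) (x : ℝ) : ℝ :=
  (Nat.card {r : Fin j → ℕ // 1 / x ≤ prodP p j r} : ℝ)

/-- Expected number of occupied boxes in generation `j` of the Poissonized scheme:
`Φ_j(t) = ∑_{r ∈ ℕ^j} (1 - e^{-t p_r})`. -/
noncomputable def PhiJ (p : ℕ → ℝ) (j : ℕ) (t : ℝ) : ℝ :=
  ∑' r : Fin j → ℕ, (1 - Real.exp (-t * prodP p j r))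

open scoped ENNReal
open MeasureTheory

noncomputable def Aop (p : ℕ → ℝ) (f : ℝ → ℝ≥0∞) (t : ℝ) : ℝ≥0∞ :=
  ∑' k, if p k = 0 then 0 else f (t + Real.log (p k))

lemma Aop_iter (p : ℕ → ℝ) (f : ℝ → ℝ≥0∞) (j : ℕ) (t : ℝ) :
    (Aop p)^[j] f t = ∑' r : Fin j → ℕ, if prodP p j r = 0 then 0 else
      f (t + Real.log (prodP p j r)) := by
  induction j generalizing t with
  | zero => simp [prodP]
  | succ j ih =>
    rw [Function.iterate_succ_apply', Aop]
    rw [← (Fin.consEquiv (fun _ : Fin (j+1) => ℕ)).tsum_eq, ENNReal.tsum_prod']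
    refine tsum_congr fun k => ?_
    have hp : ∀ r : Fin j → ℕ, prodP p (j+1) (Fin.consEquiv (fun _ : Fin (j+1) => ℕ) (k, r))
        = p k * prodP p j r := by
      intro r
      simp [prodP, Fin.prod_univ_succ, Fin.consEquiv]
    split_ifs with h
    · simp [hp, h]
    · rw [ih]
      refine tsum_congr fun r => ?_
      rw [hp]
      by_cases h2 : prodP p j r = 0
      · simp [h2]
      · simp only [h2, mul_eq_zero, h, or_self, if_false]
        rw [Real.log_mul h h2, add_assoc]

lemma Aop_mono (p : ℕ → ℝ) {f g : ℝ → ℝ≥0∞} (h : ∀ t, f t ≤ g t) (t : ℝ) :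
    Aop p f t ≤ Aop p g t := by
  refine ENNReal.tsum_le_tsum fun k => ?_
  split_ifs
  · exact le_rfl
  · exact h _

lemma Aop_iter_mono (p : ℕ → ℝ) {f g : ℝ → ℝ≥0∞} (h : ∀ t, f t ≤ g t) (j : ℕ) (t : ℝ) :
    (Aop p)^[j] f t ≤ (Aop p)^[j] g t := by
  rw [Aop_iter, Aop_iter]
  refine ENNReal.tsum_le_tsum fun k => ?_
  split_ifs
  · exact le_rfl
  · exact h _

lemma Aop_iter_lin (p : ℕ → ℝ) (f g : ℝ → ℝ≥0∞) (a b : ℝ≥0∞) (j : ℕ) (t : ℝ) :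
    (Aop p)^[j] (fun u => a * f u + b * g u) t
      = a * (Aop p)^[j] f t + b * (Aop p)^[j] g t := by
  simp only [Aop_iter]
  rw [← ENNReal.tsum_mul_left, ← ENNReal.tsum_mul_left, ← ENNReal.tsum_add]
  refine tsum_congr fun k => ?_
  split_ifs <;> simp

lemma Aop_iter_smul (p : ℕ → ℝ) (f : ℝ → ℝ≥0∞) (a : ℝ≥0∞) (j : ℕ) (t : ℝ) :
    (Aop p)^[j] (fun u => a * f u) t = a * (Aop p)^[j] f t := by
  simpa using Aop_iter_lin p f 0 a 0 j t

lemma Aop_iter_shift (p : ℕ → ℝ) (f : ℝ → ℝ≥0∞) (s : ℝ) (j : ℕ) (t : ℝ) :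
    (Aop p)^[j] (fun u => f (u + s)) t = (Aop p)^[j] f (t + s) := by
  simp only [Aop_iter]
  refine tsum_congr fun k => ?_
  rw [add_right_comm]

def Lsim (f g : ℝ → ℝ≥0∞) : Prop :=
  ∀ c : ℝ, 1 < c → ∀ᶠ t in atTop, f t ≤ ENNReal.ofReal c * g t

lemma Lsim.trans {f g h : ℝ → ℝ≥0∞} (h1 : Lsim f g) (h2 : Lsim g h) : Lsim f h := by
  intro c hc
  have hs : 1 < Real.sqrt c := by
    rw [Real.lt_sqrt (by norm_num)]; simpa using hc
  filter_upwards [h1 _ hs, h2 _ hs] with t ht1 ht2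
  calc f t ≤ ENNReal.ofReal (√c) * g t := ht1
    _ ≤ ENNReal.ofReal (√c) * (ENNReal.ofReal (√c) * h t) := by gcongr
    _ = ENNReal.ofReal c * h t := by
      rw [← mul_assoc, ← ENNReal.ofReal_mul (Real.sqrt_nonneg _),
        Real.mul_self_sqrt (by linarith)]

lemma Lsim.shift {f g : ℝ → ℝ≥0∞} (h1 : Lsim f g) (s : ℝ) :
    Lsim (fun t => f (t + s)) (fun t => g (t + s)) := by
  intro c hc
  exact (tendsto_atTop_add_const_right atTop s tendsto_id).eventually (h1 c hc)

lemma Lsim_of_tendsto {f g : ℝ → ℝ} (hg : ∀ᶠ t in atTop, 0 < g t)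
    (h : Tendsto (fun t => f t / g t) atTop (𝓝 1)) :
    Lsim (fun t => ENNReal.ofReal (f t)) (fun t => ENNReal.ofReal (g t)) ∧
    Lsim (fun t => ENNReal.ofReal (g t)) (fun t => ENNReal.ofReal (f t)) := by
  constructor
  · intro c hc
    filter_upwards [hg, h.eventually (gt_mem_nhds hc)] with t h1 h2
    rw [← ENNReal.ofReal_mul (by linarith)]
    apply ENNReal.ofReal_le_ofReal
    rw [div_lt_iff₀ h1] at h2
    exact h2.le
  · intro c hc
    have hc' : c⁻¹ < 1 := inv_lt_one_of_one_lt₀ hc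
    filter_upwards [hg, h.eventually (lt_mem_nhds hc')] with t h1 h2
    rw [← ENNReal.ofReal_mul (by linarith)]
    apply ENNReal.ofReal_le_ofReal
    rw [lt_div_iff₀ h1, inv_mul_lt_iff₀ (by linarith)] at h2
    exact h2.le

structure Kern (p : ℕ → ℝ) (F : ℝ → ℝ≥0∞) (K : ℝ → ℝ≥0∞) : Prop where
  bd : ∃ δ > 0, ∃ C > 0, ∀ u, K u ≤ ENNReal.ofReal (C * Real.exp (-δ * |u|))
  up : Lsim (Aop p K) F
  lo : Lsim F (Aop p K)

lemma Kern.shift {p : ℕ → ℝ} {F K : ℝ → ℝ≥0∞} (hK : Kern p F K) (s : ℝ)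
    (h1 : Lsim (fun t => F (t + s)) F) (h2 : Lsim F (fun t => F (t + s))) :
    Kern p F (fun u => K (u + s)) := by
  have hA : Aop p (fun u => K (u + s)) = fun t => Aop p K (t + s) := by
    funext t
    exact Aop_iter_shift p K s 1 t
  refine ⟨?_, ?_, ?_⟩
  · obtain ⟨δ, hδ, C, hC, h⟩ := hK.bd
    refine ⟨δ, hδ, C * Real.exp (δ * |s|), by positivity, fun u => (h _).trans ?_⟩
    apply ENNReal.ofReal_le_ofReal
    rw [mul_assoc, ← Real.exp_add]
    gcongr
    have : |u| ≤ |u + s| + |s| := by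
      have := abs_sub (u + s) s
      simpa using this
    nlinarith
  · rw [hA]; exact (hK.up.shift s).trans h1
  · rw [hA]; exact h2.trans (hK.lo.shift s)

/-- exponential kernel -/
noncomputable def Ek (a : ℝ) (u : ℝ) : ℝ≥0∞ := ENNReal.ofReal (Real.exp (-a * |u|))

lemma exp_sum_fin {p : ℕ → ℝ} (hp0 : ∀ k, 0 ≤ p k) (hp1 : ∀ k, p k ≤ 1) {δ : ℝ} (hδ : 0 < δ)
    {t : ℝ} (ht0 : 0 ≤ t) (hfin : Aop p (Ek δ) t ≠ ⊤) :
    ∃ Z : ℝ≥0∞, Z ≠ ⊤ ∧ ∀ u, Aop p (fun u => ENNReal.ofReal (Real.exp (δ * u))) u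
      ≤ Z * ENNReal.ofReal (Real.exp (δ * u)) := by
  refine ⟨ENNReal.ofReal (Real.exp (δ * t)) * Aop p (Ek δ) t,
    ENNReal.mul_ne_top ENNReal.ofReal_ne_top hfin, fun u => ?_⟩
  rw [Aop, Aop, mul_right_comm, ← ENNReal.tsum_mul_left]
  refine ENNReal.tsum_le_tsum fun k => ?_
  split_ifs with h
  · simp
  · rw [Ek, ← ENNReal.ofReal_mul (by positivity), ← ENNReal.ofReal_mul (by positivity),
      ← Real.exp_add, ← Real.exp_add]
    apply ENNReal.ofReal_le_ofReal
    apply Real.exp_le_exp.mpr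
    have hl : Real.log (p k) ≤ 0 := Real.log_nonpos (hp0 k) (hp1 k)
    have : |t + Real.log (p k)| ≤ t - Real.log (p k) := by
      rw [abs_le]; constructor <;> linarith
    nlinarith

lemma exp_iter_fin {p : ℕ → ℝ} {δ : ℝ} {Z : ℝ≥0∞} (hZ : Z ≠ ⊤)
    (h : ∀ u, Aop p (fun u => ENNReal.ofReal (Real.exp (δ * u))) u
      ≤ Z * ENNReal.ofReal (Real.exp (δ * u))) (j : ℕ) (u : ℝ) :
    (Aop p)^[j] (fun u => ENNReal.ofReal (Real.exp (δ * u))) u ≠ ⊤ := by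
  have : ∀ u, (Aop p)^[j] (fun u => ENNReal.ofReal (Real.exp (δ * u))) u
      ≤ Z ^ j * ENNReal.ofReal (Real.exp (δ * u)) := by
    induction j with
    | zero => simp
    | succ j ih =>
      intro u
      rw [Function.iterate_succ_apply']
      calc _ ≤ Aop p (fun u => Z ^ j * ENNReal.ofReal (Real.exp (δ * u))) u := Aop_mono p ih u
        _ = Z ^ j * Aop p (fun u => ENNReal.ofReal (Real.exp (δ * u))) u :=
          Aop_iter_smul p (fun u => ENNReal.ofReal (Real.exp (δ * u))) _ 1 u
        _ ≤ Z ^ j * (Z * ENNReal.ofReal (Real.exp (δ * u))) := by gcongr; exact h u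
        _ = _ := by ring
  exact ne_top_of_le_ne_top (ENNReal.mul_ne_top (ENNReal.pow_ne_top hZ) ENNReal.ofReal_ne_top)
    (this u)

/-- main induction -/
lemma main_ind {p : ℕ → ℝ} (hp0 : ∀ k, 0 ≤ p k) (hp1 : ∀ k, p k ≤ 1)
    (hpinf : {k | 0 < p k}.Infinite) {F : ℝ → ℝ≥0∞} (hF : ∀ t, F t ≠ ⊤)
    (hF1 : ∀ s, Lsim (fun t => F (t + s)) F) (hF2 : ∀ s, Lsim F (fun t => F (t + s)))
    (hE : ∀ a > 0, Kern p F (fun u => ENNReal.ofReal (a / 2) * Ek a u))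
    (j : ℕ) : ∀ K₁ K₂ : ℝ → ℝ≥0∞, Kern p F K₁ → Kern p F K₂ →
      Lsim ((Aop p)^[j+1] K₁) ((Aop p)^[j+1] K₂) := by
  have hEfin : ∀ a > 0, ∃ t, 0 ≤ t ∧ Aop p (Ek a) t ≠ ⊤ := by
    intro a ha
    obtain ⟨t, h1, h2⟩ := (((hE a ha).up 2 (by norm_num)).and (eventually_ge_atTop 0)).exists
    refine ⟨t, h2, fun h => ?_⟩
    have : Aop p (fun u => ENNReal.ofReal (a / 2) * Ek a u) t
        = ENNReal.ofReal (a / 2) * Aop p (Ek a) t := Aop_iter_smul p _ _ 1 t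
    rw [this, h, ENNReal.mul_top (by simpa using ha)] at h1
    exact (ENNReal.mul_ne_top ENNReal.ofReal_ne_top (hF t)) (top_le_iff.mp h1)
  induction j with
  | zero =>
    intro K₁ K₂ h1 h2
    exact h1.up.trans h2.lo
  | succ j ih =>
    intro K₁ K₂ h1 h2
    -- small o
    have hsmall : ∀ m : ℕ, ∀ᶠ t in atTop,
        (m : ℝ≥0∞) * (Aop p)^[j+1] K₂ t ≤ 2 * (Aop p)^[j+1+1] K₂ t := by
      intro m
      obtain ⟨s, hs, hcard⟩ := hpinf.exists_subset_card_eq m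
      have hev : ∀ᶠ t in atTop, ∀ k ∈ s,
          (Aop p)^[j+1] K₂ t ≤ 2 * (Aop p)^[j+1] K₂ (t + Real.log (p k)) := by
        rw [Filter.eventually_all_finset]
        intro k _
        have := ih K₂ _ h2 (h2.shift (Real.log (p k)) (hF1 _) (hF2 _)) 2 (by norm_num)
        filter_upwards [this] with t ht
        rw [Aop_iter_shift] at ht
        simpa using ht
      filter_upwards [hev] with t ht
      rw [Function.iterate_succ_apply' (Aop p) (j+1)]
      calc (m : ℝ≥0∞) * (Aop p)^[j+1] K₂ t = ∑ k ∈ s, (Aop p)^[j+1] K₂ t := by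
            simp [hcard]
        _ ≤ ∑ k ∈ s, 2 * (if p k = 0 then 0 else (Aop p)^[j+1] K₂ (t + Real.log (p k))) := by
            refine Finset.sum_le_sum fun k hk => ?_
            have : p k ≠ 0 := ne_of_gt (hs hk)
            rw [if_neg this]
            exact ht k hk
        _ = 2 * ∑ k ∈ s, (if p k = 0 then 0 else (Aop p)^[j+1] K₂ (t + Real.log (p k))) := by
            rw [Finset.mul_sum]
        _ ≤ _ := by
            gcongr
            exact ENNReal.sum_le_tsum s
    intro c hc
    set c' := (1 + c) / 2 with hc'
    have hc1 : 1 < c' := by rw [hc']; linarith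
    obtain ⟨M, hM⟩ := (((h1.up.trans h2.lo) c' hc1).and (eventually_ge_atTop 0)).exists_forall_of_atTop
    obtain ⟨δ, hδ, C, hC, hb⟩ := h1.bd
    obtain ⟨t0, ht0, hfin⟩ := hEfin δ hδ
    obtain ⟨Z, hZ, hZb⟩ := exp_sum_fin hp0 hp1 hδ ht0 hfin
    have hM0 : 0 ≤ M := (hM M le_rfl).2
    have hAK : ∀ u, Aop p K₁ u ≤ ENNReal.ofReal C * Z * ENNReal.ofReal (Real.exp (δ * u)) := by
      intro u
      calc Aop p K₁ u ≤ Aop p (fun u => ENNReal.ofReal C * ENNReal.ofReal (Real.exp (δ * u))) u := by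
            refine Aop_mono p (fun t => (hb t).trans ?_) u
            rw [← ENNReal.ofReal_mul hC.le]
            apply ENNReal.ofReal_le_ofReal
            refine mul_le_mul_of_nonneg_left (Real.exp_le_exp.mpr ?_) hC.le
            nlinarith [neg_abs_le t]
        _ = ENNReal.ofReal C * Aop p (fun u => ENNReal.ofReal (Real.exp (δ * u))) u :=
            Aop_iter_smul p (fun u => ENNReal.ofReal (Real.exp (δ * u))) _ 1 u
        _ ≤ _ := by rw [mul_assoc]; gcongr; exact hZb u
    set B : ℝ≥0∞ := ENNReal.ofReal C * Z * ENNReal.ofReal (Real.exp (2 * δ * M)) with hB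
    have hBfin : B ≠ ⊤ := ENNReal.mul_ne_top (ENNReal.mul_ne_top ENNReal.ofReal_ne_top hZ)
      ENNReal.ofReal_ne_top
    have hpt : ∀ u, Aop p K₁ u ≤ ENNReal.ofReal c' * Aop p K₂ u + B * Ek δ u := by
      intro u
      rcases le_or_gt M u with h | h
      · exact (hM u h).1.trans le_self_add
      · refine (hAK u).trans (le_trans ?_ le_add_self)
        rw [hB, mul_assoc (ENNReal.ofReal C * Z), Ek, ← ENNReal.ofReal_mul (by positivity),
          ← Real.exp_add]
        gcongr
        have : |u| ≤ 2 * M - u := by rw [abs_le]; constructor <;> linarith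
        nlinarith
    -- use P(j)
    have hEj := ih _ K₂ (hE δ hδ) h2 2 (by norm_num)
    set B2 : ℝ≥0∞ := B * (ENNReal.ofReal (2 / δ) * 2) with hB2
    have hB2fin : B2 ≠ ⊤ := ENNReal.mul_ne_top hBfin
      (ENNReal.mul_ne_top ENNReal.ofReal_ne_top (by norm_num))
    obtain ⟨m, hm⟩ := exists_nat_gt ((B2.toReal * 2) / (c - c'))
    have hcc : 0 < c - c' := by rw [hc']; linarith
    have hmpos : (0:ℝ) < m := lt_of_le_of_lt (by positivity) hm
    filter_upwards [hEj, hsmall m] with t hEt hst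
    have h3 : (Aop p)^[j+1] (Ek δ) t ≤ ENNReal.ofReal (2 / δ) * 2 * (Aop p)^[j+1] K₂ t := by
      rw [Aop_iter_smul] at hEt
      calc (Aop p)^[j+1] (Ek δ) t
          = ENNReal.ofReal (2 / δ) * (ENNReal.ofReal (δ / 2) * (Aop p)^[j+1] (Ek δ) t) := by
            rw [← mul_assoc, ← ENNReal.ofReal_mul (by positivity)]
            have : 2 / δ * (δ / 2) = 1 := by field_simp
            rw [this]; simp
        _ ≤ _ := by
            rw [mul_assoc]
            refine mul_le_mul_right ?_ _
            rwa [show ENNReal.ofReal 2 = 2 by simp] at hEt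
    have h4 : B2 * (Aop p)^[j+1] K₂ t ≤ ENNReal.ofReal (c - c') * (Aop p)^[j+1+1] K₂ t := by
      have hB2' : B2 * 2 ≤ ENNReal.ofReal (c - c') * m := by
        rw [← ENNReal.ofReal_toReal hB2fin]
        have : (2:ℝ≥0∞) = ENNReal.ofReal 2 := by simp
        rw [this, ← ENNReal.ofReal_mul ENNReal.toReal_nonneg, ← ENNReal.ofReal_natCast,
          ← ENNReal.ofReal_mul hcc.le]
        apply ENNReal.ofReal_le_ofReal
        rw [div_lt_iff₀ hcc] at hm
        linarith
      have h5 : 2 * (B2 * (Aop p)^[j+1] K₂ t)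
          ≤ 2 * (ENNReal.ofReal (c - c') * (Aop p)^[j+1+1] K₂ t) := by
        calc 2 * (B2 * (Aop p)^[j+1] K₂ t) = (B2 * 2) * (Aop p)^[j+1] K₂ t := by ring
          _ ≤ ENNReal.ofReal (c - c') * m * (Aop p)^[j+1] K₂ t := by gcongr
          _ = ENNReal.ofReal (c - c') * (m * (Aop p)^[j+1] K₂ t) := by ring
          _ ≤ ENNReal.ofReal (c - c') * (2 * (Aop p)^[j+1+1] K₂ t) := by gcongr
          _ = _ := by ring
      exact (ENNReal.mul_le_mul_iff_right (by norm_num) (by norm_num)).mp h5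
    calc (Aop p)^[j+1+1] K₁ t = (Aop p)^[j+1] (Aop p K₁) t := by
          rw [Function.iterate_succ_apply]
      _ ≤ (Aop p)^[j+1] (fun u => ENNReal.ofReal c' * Aop p K₂ u + B * Ek δ u) t :=
          Aop_iter_mono p hpt _ t
      _ = ENNReal.ofReal c' * (Aop p)^[j+1+1] K₂ t + B * (Aop p)^[j+1] (Ek δ) t := by
          rw [Aop_iter_lin, Function.iterate_succ_apply (Aop p) (j+1)]
      _ ≤ ENNReal.ofReal c' * (Aop p)^[j+1+1] K₂ t
            + ENNReal.ofReal (c - c') * (Aop p)^[j+1+1] K₂ t := by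
          refine add_le_add le_rfl ?_
          refine le_trans ?_ h4
          rw [hB2, mul_assoc B]
          exact mul_le_mul_right h3 B
      _ = ENNReal.ofReal c * (Aop p)^[j+1+1] K₂ t := by
          rw [← add_mul, ← ENNReal.ofReal_add (by linarith) hcc.le]
          congr 2; ring

/-- exponential domination of increments -/
lemma incr_dom {N : ℝ → ℝ} (hmono : Monotone N) (hN0 : ∀ s, 0 ≤ N s)
    (hlim : ∀ h, Tendsto (fun s => (N (s + h) - N s) / (N (s + 1) - N s)) atTop (𝓝 h))
    (hF : ∀ᶠ s in atTop, 1 ≤ N (s + 1) - N s) {δ : ℝ} (hδ : 0 < δ) :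
    ∃ D > 0, ∀ᶠ t in atTop, ∀ v, |N (t + v) - N t| ≤
      D * Real.exp (δ * |v|) * (N (t + 1) - N t) := by
  set q := Real.exp δ with hq
  set r := Real.exp (δ / 2) with hr
  have hr1 : 1 < r := Real.one_lt_exp_iff.mpr (by linarith)
  have hrq : r < q := Real.exp_lt_exp.mpr (by linarith)
  have hF1 : Tendsto (fun s => (N (s + 1 + 1) - N (s + 1)) / (N (s + 1) - N s)) atTop (𝓝 1) := by
    have := (hlim 2).sub (hlim 1)
    norm_num at this
    refine this.congr fun s => ?_
    rw [← sub_div, add_assoc]; norm_num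
  have hev : ∀ᶠ s in atTop, 1 ≤ N (s + 1) - N s ∧
      N (s + 1 + 1) - N (s + 1) ≤ r * (N (s + 1) - N s) ∧
      N (s + 1) - N s ≤ r * (N (s + 1 + 1) - N (s + 1)) := by
    have hr' : r⁻¹ < 1 := inv_lt_one_of_one_lt₀ hr1
    filter_upwards [hF, hF1.eventually (gt_mem_nhds hr1), hF1.eventually (lt_mem_nhds hr')]
      with s h1 h2 h3
    rw [div_lt_iff₀ (by linarith)] at h2
    rw [lt_div_iff₀ (by linarith), inv_mul_lt_iff₀ (by linarith)] at h3
    exact ⟨h1, h2.le, h3.le⟩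
  obtain ⟨T, hT⟩ := hev.exists_forall_of_atTop
  set D := r / (q - r) + N (T + 1) with hD
  have hqr : 0 < q - r := by linarith
  have hD1 : r ≤ D * (q - r) := by
    rw [hD, add_mul, div_mul_cancel₀ _ hqr.ne']
    nlinarith [hN0 (T + 1)]
  have hD2 : N (T + 1) ≤ D := by
    rw [hD]; have : 0 < r / (q - r) := by positivity
    linarith
  have hDpos : 0 < D := by
    rw [hD]; have : 0 < r / (q - r) := by positivity
    linarith [hN0 (T + 1)]
  have hq1 : 1 < q := by linarith
  have hqm : ∀ m : ℕ, 1 ≤ q ^ m := fun m => one_le_pow₀ hq1.le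
  have hup : ∀ m : ℕ, ∀ t ≥ T, N (t + m) - N t ≤ D * q ^ m * (N (t + 1) - N t) := by
    intro m
    induction m with
    | zero => intro t ht; simp; have := (hT t ht).1; nlinarith
    | succ m ih =>
      intro t ht
      have h1 := ih (t + 1) (by linarith)
      obtain ⟨h2, h3, h4⟩ := hT t ht
      have e : t + ((m + 1 : ℕ) : ℝ) = t + 1 + m := by push_cast; ring
      rw [e]
      have h5 : D * q ^ m * (N (t + 1 + 1) - N (t + 1)) ≤ D * q ^ m * (r * (N (t + 1) - N t)) := by
        gcongr
      have h6 : 1 + D * q ^ m * r ≤ D * q ^ (m + 1) := by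
        have : 1 ≤ D * (q - r) * q ^ m := by nlinarith [hqm m]
        rw [pow_succ]; nlinarith
      nlinarith
  have hdn : ∀ m : ℕ, ∀ t ≥ T, N t - N (t - m) ≤ D * q ^ m * (N (t + 1) - N t) := by
    intro m
    induction m with
    | zero => intro t ht; simp; have := (hT t ht).1; nlinarith
    | succ m ih =>
      intro t ht
      rcases le_or_gt (T + 1) t with h | h
      · have h1 := ih (t - 1) (by linarith)
        obtain ⟨h2, h3, h4⟩ := hT (t - 1) (by linarith)
        have e : t - ((m + 1 : ℕ) : ℝ) = t - 1 - m := by push_cast; ring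
        rw [e]
        simp only [sub_add_cancel] at h1 h2 h3 h4
        have h0 := (hT t ht).1
        have h6 : r * (1 + D * q ^ m) ≤ D * q ^ (m + 1) := by
          have : r ≤ D * (q - r) * q ^ m := by nlinarith [hqm m]
          rw [pow_succ]; nlinarith
        have hpos : 0 ≤ 1 + D * q ^ m := by positivity
        calc N t - N (t - 1 - m) ≤ (1 + D * q ^ m) * (N t - N (t - 1)) := by linarith
          _ ≤ (1 + D * q ^ m) * (r * (N (t + 1) - N t)) := by gcongr
          _ = r * (1 + D * q ^ m) * (N (t + 1) - N t) := by ring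
          _ ≤ _ := by gcongr
      · have h0 := (hT t ht).1
        have h1 : N t ≤ N (T + 1) := hmono h.le
        calc N t - N (t - ((m + 1 : ℕ) : ℝ)) ≤ D := by linarith [hN0 (t - ((m + 1 : ℕ) : ℝ))]
          _ = D * 1 * 1 := by ring
          _ ≤ _ := by gcongr; exact hqm _
  refine ⟨D * q, by positivity, ?_⟩
  filter_upwards [eventually_ge_atTop T] with t ht v
  set m := ⌈|v|⌉₊ with hm
  have hm1 : |v| ≤ m := Nat.le_ceil _
  have hm2 : (m : ℝ) < |v| + 1 := Nat.ceil_lt_add_one (abs_nonneg v)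
  have hqm2 : q ^ m ≤ q * Real.exp (δ * |v|) := by
    rw [hq, ← Real.exp_nat_mul, ← Real.exp_add]
    apply Real.exp_le_exp.mpr
    nlinarith
  have h0 := (hT t ht).1
  have key : |N (t + v) - N t| ≤ D * q ^ m * (N (t + 1) - N t) := by
    rw [abs_le]
    have h1 := hup m t ht
    have h2 := hdn m t ht
    obtain ⟨hv1, hv2⟩ := abs_le.mp hm1
    have h3 : N (t + v) ≤ N (t + m) := hmono (by linarith)
    have h4 : N (t - m) ≤ N (t + v) := hmono (by linarith)
    constructor <;> linarith
  refine key.trans ?_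
  have : D * q ^ m ≤ D * q * Real.exp (δ * |v|) := by
    rw [mul_assoc]; gcongr
  gcongr

lemma integrable_exp_abs {b : ℝ} (hb : 0 < b) : Integrable (fun v : ℝ => Real.exp (-b * |v|)) := by
  rw [← integrableOn_univ, ← Set.Iic_union_Ioi (a := (0:ℝ))]
  refine IntegrableOn.union ?_ ?_
  · refine (integrableOn_exp_mul_Iic hb 0).congr_fun (fun v hv => ?_) measurableSet_Iic
    simp [abs_of_nonpos (Set.mem_Iic.mp hv)]
  · refine (integrableOn_exp_mul_Ioi (neg_lt_zero.mpr hb) 0).congr_fun (fun v hv => ?_)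
      measurableSet_Ioi
    simp [abs_of_pos (Set.mem_Ioi.mp hv)]

/-- dominated convergence for layer-cake kernels -/
lemma layer_tendsto {N : ℝ → ℝ} (hmono : Monotone N) (hN0 : ∀ s, 0 ≤ N s)
    (hlim : ∀ h, Tendsto (fun s => (N (s + h) - N s) / (N (s + 1) - N s)) atTop (𝓝 h))
    (hF : ∀ᶠ s in atTop, 1 ≤ N (s + 1) - N s)
    {h α γ : ℝ → ℝ} (hm : Measurable h) (hα : Measurable α) (hγ : Measurable γ)
    (hh0 : ∀ v, 0 ≤ h v) {b C : ℝ} (hb : 0 < b) 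
    (hhb : ∀ v, h v ≤ C * Real.exp (-b * |v|))
    (hαb : ∀ v, |α v| ≤ |v| + 1) (hγb : ∀ v, |γ v| ≤ |v| + 1) :
    (∀ᶠ t in atTop, Integrable (fun v => h v * (N (t + α v) - N (t + γ v)))) ∧
    Tendsto (fun t => (∫ v, h v * (N (t + α v) - N (t + γ v))) / (N (t + 1) - N t))
      atTop (𝓝 (∫ v, h v * (α v - γ v))) := by
  obtain ⟨D, hD, hdom⟩ := incr_dom hmono hN0 hlim hF (δ := b / 2) (by linarith)
  have hC : 0 ≤ C := by
    have := (hh0 0).trans (hhb 0)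
    simpa using this
  set bound : ℝ → ℝ := fun v => C * (2 * D * Real.exp (b / 2)) * Real.exp (-(b / 2) * |v|) with hbd
  have hbi : Integrable bound := (integrable_exp_abs (by linarith)).const_mul _
  have hNm : Measurable N := hmono.measurable
  have hmeas : ∀ t, Measurable (fun v => h v * (N (t + α v) - N (t + γ v))) := by
    intro t
    exact hm.mul ((hNm.comp (hα.const_add t)).sub (hNm.comp (hγ.const_add t)))
  have hbnd : ∀ᶠ t in atTop, 1 ≤ N (t + 1) - N t ∧ ∀ v,
      |h v * (N (t + α v) - N (t + γ v))| ≤ bound v * (N (t + 1) - N t) := by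
    filter_upwards [hdom, hF] with t ht hFt
    refine ⟨hFt, fun v => ?_⟩
    rw [abs_mul, abs_of_nonneg (hh0 v)]
    have aux : ∀ w, |w| ≤ |v| + 1 → |N (t + w) - N t| ≤
        D * Real.exp (b / 2) * Real.exp (b / 2 * |v|) * (N (t + 1) - N t) := by
      intro w hw
      refine (ht w).trans ?_
      have : Real.exp (b / 2 * |w|) ≤ Real.exp (b / 2) * Real.exp (b / 2 * |v|) := by
        rw [← Real.exp_add]; apply Real.exp_le_exp.mpr; nlinarith
      have h2 : D * Real.exp (b / 2 * |w|) ≤ D * Real.exp (b / 2) * Real.exp (b / 2 * |v|) := by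
        rw [mul_assoc]; gcongr
      gcongr
    have h1 := aux _ (hαb v)
    have h2 := aux _ (hγb v)
    have h3 : |N (t + α v) - N (t + γ v)| ≤
        2 * D * Real.exp (b / 2) * Real.exp (b / 2 * |v|) * (N (t + 1) - N t) := by
      have e : N (t + α v) - N (t + γ v) = (N (t + α v) - N t) - (N (t + γ v) - N t) := by ring
      rw [e]
      refine (abs_sub _ _).trans ?_
      linarith
    calc h v * |N (t + α v) - N (t + γ v)|
        ≤ (C * Real.exp (-b * |v|)) *
          (2 * D * Real.exp (b / 2) * Real.exp (b / 2 * |v|) * (N (t + 1) - N t)) := by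
          gcongr; exact hhb v
      _ = C * (2 * D * Real.exp (b / 2)) * (Real.exp (-b * |v|) * Real.exp (b / 2 * |v|))
            * (N (t + 1) - N t) := by ring
      _ = _ := by
          rw [hbd, ← Real.exp_add]; ring_nf
  constructor
  · filter_upwards [hbnd] with t ht
    refine (hbi.mul_const (N (t + 1) - N t)).mono' (hmeas t).aestronglyMeasurable ?_
    exact Eventually.of_forall fun v => ht.2 v
  · simp_rw [← integral_div]
    refine tendsto_integral_filter_of_dominated_convergence bound ?_ ?_ hbi ?_
    · exact Eventually.of_forall fun t => ((hmeas t).div_const _).aestronglyMeasurable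
    · filter_upwards [hbnd] with t ht
      refine Eventually.of_forall fun v => ?_
      rw [Real.norm_eq_abs, abs_div, abs_of_pos (by linarith [ht.1] : 0 < N (t + 1) - N t),
        div_le_iff₀ (by linarith [ht.1])]
      exact ht.2 v
    · refine Eventually.of_forall fun v => ?_
      have := ((hlim (α v)).sub (hlim (γ v))).const_mul (h v)
      refine this.congr fun t => ?_
      rw [← sub_div, mul_div_assoc]
      ring_nf

noncomputable def cnt (p : ℕ → ℝ) (s : ℝ) : ℝ := (Set.ncard {k | Real.exp (-s) ≤ p k} : ℝ)

lemma cnt_finite {p : ℕ → ℝ} (hs : Summable p) (s : ℝ) : {k | Real.exp (-s) ≤ p k}.Finite := by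
  have h := hs.tendsto_cofinite_zero.eventually (gt_mem_nhds (Real.exp_pos (-s)))
  rw [Filter.eventually_cofinite] at h
  refine h.subset fun k hk => ?_
  simpa using hk

lemma cnt_mono {p : ℕ → ℝ} (hs : Summable p) : Monotone (cnt p) := by
  intro s t hst
  unfold cnt
  have : {k | Real.exp (-s) ≤ p k} ⊆ {k | Real.exp (-t) ≤ p k} := fun k hk =>
    le_trans (Real.exp_le_exp.mpr (by linarith)) hk
  exact_mod_cast Set.ncard_le_ncard this (cnt_finite hs t)

lemma rho_cnt (p : ℕ → ℝ) (s : ℝ) : rhoJ p 1 (Real.exp s) = cnt p s := by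
  unfold rhoJ cnt
  rw [← Nat.card_coe_set_eq]
  congr 1
  refine Nat.card_congr ((Equiv.funUnique (Fin 1) ℕ).subtypeEquiv fun r => ?_)
  simp [prodP, Real.exp_neg]

lemma cnt_sum {p : ℕ → ℝ} (hp0 : ∀ k, 0 ≤ p k) (hs : Summable p) (x : ℝ≥0∞) (t : ℝ) {α γ : ℝ}
    (h : γ ≤ α) :
    (∑' k, if p k = 0 then 0 else
      (if γ < -(t + Real.log (p k)) ∧ -(t + Real.log (p k)) ≤ α then x else 0))
    = x * ENNReal.ofReal (cnt p (t + α) - cnt p (t + γ)) := by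
  set S := (cnt_finite hs (t + α)).toFinset with hS
  set S' := (cnt_finite hs (t + γ)).toFinset with hS'
  have hsub : S' ⊆ S := by
    intro k hk
    simp only [hS, hS', Set.Finite.mem_toFinset, Set.mem_setOf_eq] at hk ⊢
    exact le_trans (Real.exp_le_exp.mpr (by linarith)) hk
  have hmem : ∀ k, (p k ≠ 0 ∧ γ < -(t + Real.log (p k)) ∧ -(t + Real.log (p k)) ≤ α) ↔
      k ∈ S \ S' := by
    intro k
    simp only [hS, hS', Finset.mem_sdiff, Set.Finite.mem_toFinset, Set.mem_setOf_eq, not_le]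
    by_cases hk : p k = 0
    · simp [hk, Real.exp_pos]
    · have hpos : 0 < p k := lt_of_le_of_ne (hp0 k) (Ne.symm hk)
      rw [← Real.le_log_iff_exp_le hpos, ← Real.log_lt_iff_lt_exp hpos]
      constructor
      · rintro ⟨_, h1, h2⟩; constructor <;> linarith
      · rintro ⟨h1, h2⟩; refine ⟨hk, ?_, ?_⟩ <;> linarith
  have hc : cnt p (t + α) - cnt p (t + γ) = ((S \ S').card : ℝ) := by
    rw [Finset.card_sdiff_of_subset hsub, Nat.cast_sub (Finset.card_le_card hsub)]
    unfold cnt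
    rw [Set.ncard_eq_toFinset_card _ (cnt_finite hs _), Set.ncard_eq_toFinset_card _ (cnt_finite hs _)]
  rw [hc, ENNReal.ofReal_natCast]
  rw [tsum_eq_sum (s := S \ S')]
  · rw [Finset.sum_congr rfl (g := fun _ => x)]
    · simp [mul_comm]
    · intro k hk
      obtain ⟨h1, h2⟩ := (hmem k).mpr hk
      rw [if_neg h1, if_pos h2]
  · intro k hk
    rw [← hmem] at hk
    split_ifs with h1 h2
    · rfl
    · exact absurd ⟨h1, h2⟩ hk
    · rfl

lemma kern_layer {p : ℕ → ℝ} (hp0 : ∀ k, 0 ≤ p k) (hs : Summable p)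
    (hlim : ∀ h, Tendsto (fun s => (cnt p (s + h) - cnt p s) / (cnt p (s + 1) - cnt p s))
      atTop (𝓝 h))
    (hF : ∀ᶠ s in atTop, 1 ≤ cnt p (s + 1) - cnt p s)
    {h α γ : ℝ → ℝ} (hm : Measurable h) (hα : Measurable α) (hγ : Measurable γ)
    (hh0 : ∀ v, 0 ≤ h v) {b C : ℝ} (hb : 0 < b)
    (hhb : ∀ v, h v ≤ C * Real.exp (-b * |v|))
    (hαb : ∀ v, |α v| ≤ |v| + 1) (hγb : ∀ v, |γ v| ≤ |v| + 1) (hγα : ∀ v, γ v ≤ α v)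
    (hI : ∫ v, h v * (α v - γ v) = 1) (K : ℝ → ℝ≥0∞)
    (hK : ∀ u, K u = ∫⁻ v, if γ v < -u ∧ -u ≤ α v then ENNReal.ofReal (h v) else 0)
    (hbd : ∃ δ > 0, ∃ C > 0, ∀ u, K u ≤ ENNReal.ofReal (C * Real.exp (-δ * |u|))) :
    Kern p (fun t => ENNReal.ofReal (cnt p (t + 1) - cnt p t)) K := by
  obtain ⟨hIntg, hten⟩ := layer_tendsto (cnt_mono hs) (fun s => by unfold cnt; positivity)
    hlim hF hm hα hγ hh0 hb hhb hαb hγb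
  rw [hI] at hten
  have hA : ∀ᶠ t in atTop, Aop p K t =
      ENNReal.ofReal (∫ v, h v * (cnt p (t + α v) - cnt p (t + γ v))) := by
    filter_upwards [hIntg] with t ht
    have hnn : ∀ v, 0 ≤ cnt p (t + α v) - cnt p (t + γ v) := fun v => by
      have := cnt_mono hs (show t + γ v ≤ t + α v by linarith [hγα v]); linarith
    rw [ofReal_integral_eq_lintegral_ofReal ht
      (Eventually.of_forall fun v => mul_nonneg (hh0 v) (hnn v))]
    unfold Aop
    have e1 : ∀ k, (if p k = 0 then 0 else K (t + Real.log (p k))) =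
        ∫⁻ v, (if p k = 0 then 0 else
        (if γ v < -(t + Real.log (p k)) ∧ -(t + Real.log (p k)) ≤ α v then
          ENNReal.ofReal (h v) else 0)) := by
      intro k
      split_ifs with hk
      · simp
      · rw [hK]
    simp_rw [e1]
    rw [← lintegral_tsum]
    · refine lintegral_congr fun v => ?_
      rw [cnt_sum hp0 hs _ t (hγα v), ENNReal.ofReal_mul (hh0 v)]
    · intro k
      apply Measurable.aemeasurable
      by_cases hk : p k = 0
      · simp [hk]
      · simp only [hk, if_false]
        refine Measurable.ite ?_ hm.ennreal_ofReal measurable_const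
        exact (measurableSet_lt hγ measurable_const).inter (measurableSet_le measurable_const hα)
  have hF0 : ∀ᶠ t in atTop, 0 < cnt p (t + 1) - cnt p t := hF.mono fun t ht => by linarith
  obtain ⟨l1, l2⟩ := Lsim_of_tendsto hF0 hten
  refine ⟨hbd, ?_, ?_⟩
  · intro c hc
    filter_upwards [hA, l1 c hc] with t h1 h2
    rw [h1]; exact h2
  · intro c hc
    filter_upwards [hA, l2 c hc] with t h1 h2
    rw [h1]; exact h2

lemma E_layer {a : ℝ} (ha : 0 < a) (u : ℝ) : ENNReal.ofReal (a / 2) * Ek a u =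
    ∫⁻ v, if -|v| < -u ∧ -u ≤ |v| then ENNReal.ofReal (a ^ 2 / 4 * Real.exp (-a * |v|)) else 0 := by
  set g : ℝ → ℝ := fun x => if |u| < x then a ^ 2 / 4 * Real.exp (-a * x) else 0 with hg
  have hae : (fun v => if -|v| < -u ∧ -u ≤ |v| then
      ENNReal.ofReal (a ^ 2 / 4 * Real.exp (-a * |v|)) else 0)
      =ᵐ[volume] fun v => ENNReal.ofReal (g |v|) := by
    have h1 : ∀ᵐ v : ℝ, v ≠ u := by simp [ae_iff]
    have h2 : ∀ᵐ v : ℝ, v ≠ -u := by simp [ae_iff]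
    filter_upwards [h1, h2] with v hv1 hv2
    have hne : |u| ≠ |v| := by
      intro h
      rcases abs_eq_abs.mp h with h | h
      · exact hv1 h.symm
      · exact hv2 (by linarith)
    have hiff : (-|v| < -u ∧ -u ≤ |v|) ↔ |u| < |v| := by
      constructor
      · rintro ⟨h3, h4⟩
        refine lt_of_le_of_ne (abs_le.mpr ⟨by linarith, by linarith⟩) hne
      · intro h
        have := abs_lt.mp h
        constructor <;> linarith
    simp only [hg, hiff]
    split_ifs <;> simp
  have hgi : g = Set.indicator (Set.Ioi |u|) (fun x => a ^ 2 / 4 * Real.exp (-a * x)) := by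
    funext x; simp [hg, Set.indicator]
  have hgm : Measurable g := by
    rw [hgi]; exact Measurable.indicator (by fun_prop) measurableSet_Ioi
  have hg0 : ∀ x, 0 ≤ g x := by
    intro x; simp only [hg]; split_ifs <;> positivity
  have hIntg : Integrable (fun v => g |v|) := by
    refine ((integrable_exp_abs ha).const_mul (a ^ 2 / 4)).mono'
      (hgm.comp measurable_norm).aestronglyMeasurable (Eventually.of_forall fun v => ?_)
    rw [Real.norm_eq_abs, abs_of_nonneg (hg0 _)]
    simp only [hg]
    split_ifs
    · exact le_rfl
    · positivity
  rw [lintegral_congr_ae hae, ← ofReal_integral_eq_lintegral_ofReal hIntg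
    (Eventually.of_forall fun v => hg0 _), integral_comp_abs, Ek,
    ← ENNReal.ofReal_mul (by positivity)]
  congr 1
  rw [hgi, setIntegral_indicator measurableSet_Ioi, Set.Ioi_inter_Ioi, 
    sup_of_le_right (abs_nonneg u), integral_const_mul, integral_exp_mul_Ioi (by linarith)]
  field_simp
  ring

lemma E_total {a : ℝ} (ha : 0 < a) :
    ∫ v : ℝ, (a ^ 2 / 4 * Real.exp (-a * |v|)) * (|v| - -|v|) = 1 := by
  have h := integral_comp_abs (f := fun x => a ^ 2 / 4 * Real.exp (-a * x) * (x - -x))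
  rw [h]
  have h2 := Real.integral_rpow_mul_exp_neg_mul_Ioi (a := 2) (r := a) (by norm_num) ha
  have h3 : ∫ x in Set.Ioi (0:ℝ), a ^ 2 / 4 * Real.exp (-a * x) * (x - -x)
      = a ^ 2 / 2 * ∫ x in Set.Ioi (0:ℝ), x ^ ((2:ℝ) - 1) * Real.exp (-(a * x)) := by
    rw [← integral_const_mul]
    refine setIntegral_congr_fun measurableSet_Ioi fun x _ => ?_
    norm_num
    ring
  rw [h3, h2]
  norm_num
  field_simp

lemma G_deriv (v : ℝ) : HasDerivAt (fun v => -Real.exp (-Real.exp v))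
    (Real.exp v * Real.exp (-Real.exp v)) v := by
  have h1 : HasDerivAt (fun v => -Real.exp v) (-Real.exp v) v := (Real.hasDerivAt_exp v).neg
  have h2 : HasDerivAt (fun v => -Real.exp (-Real.exp v))
      (-(Real.exp (-Real.exp v) * -Real.exp v)) v := h1.exp.neg
  exact h2.congr_deriv (by ring)

lemma G_bd (v : ℝ) : Real.exp v * Real.exp (-Real.exp v) ≤ 2 * Real.exp (-1 * |v|) := by
  set x := Real.exp v with hx
  have hx0 : 0 < x := Real.exp_pos v
  rcases le_total v 0 with h | h
  · rw [abs_of_nonpos h]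
    have : Real.exp (-x) ≤ 1 := Real.exp_le_one_iff.mpr (by linarith)
    have e : Real.exp (-1 * -v) = x := by simp [hx]
    rw [e]; nlinarith
  · rw [abs_of_nonneg h]
    have e : Real.exp (-1 * v) = x⁻¹ := by simp [hx, Real.exp_neg]
    rw [e, Real.exp_neg]
    have := Real.quadratic_le_exp_of_nonneg hx0.le
    rw [← div_eq_mul_inv, ← div_eq_mul_inv, div_le_div_iff₀ (Real.exp_pos _) hx0]
    nlinarith

lemma G_total : ∫ v : ℝ, Real.exp v * Real.exp (-Real.exp v) = 1 := by
  have hIntg : Integrable (fun v => Real.exp v * Real.exp (-Real.exp v)) := by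
    refine ((integrable_exp_abs (b := 1) one_pos).const_mul 2).mono' (by fun_prop)
      (Eventually.of_forall fun v => ?_)
    rw [Real.norm_eq_abs, abs_of_nonneg (by positivity)]
    exact G_bd v
  have hbot : Tendsto (fun v => -Real.exp (-Real.exp v)) atBot (𝓝 (-1)) := by
    have := ((Real.continuous_exp.tendsto 0).comp (by simpa using Real.tendsto_exp_atBot.neg)).neg
    simpa using this
  have htop : Tendsto (fun v => -Real.exp (-Real.exp v)) atTop (𝓝 0) := by
    have := (Real.tendsto_exp_atBot.comp (tendsto_neg_atTop_atBot.comp Real.tendsto_exp_atTop)).neg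
    simpa using this
  rw [integral_of_hasDerivAt_of_tendsto G_deriv hIntg hbot htop]
  norm_num

/-- the variance kernel -/
noncomputable def Gk (u : ℝ) : ℝ := Real.exp (-Real.exp u) - Real.exp (-(2 * Real.exp u))

lemma G_layer (u : ℝ) : ENNReal.ofReal (Gk u / Real.log 2) =
    ∫⁻ v, if -v < -u ∧ -u ≤ Real.log 2 - v then
      ENNReal.ofReal (Real.exp v * Real.exp (-Real.exp v) / Real.log 2) else 0 := by
  have hl : 0 < Real.log 2 := Real.log_pos (by norm_num)
  have e1 : (fun v => if -v < -u ∧ -u ≤ Real.log 2 - v then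
      ENNReal.ofReal (Real.exp v * Real.exp (-Real.exp v) / Real.log 2) else 0) =
      Set.indicator (Set.Ioc u (u + Real.log 2))
        (fun v => ENNReal.ofReal (Real.exp v * Real.exp (-Real.exp v) / Real.log 2)) := by
    funext v
    have : (-v < -u ∧ -u ≤ Real.log 2 - v) ↔ v ∈ Set.Ioc u (u + Real.log 2) := by
      rw [Set.mem_Ioc]
      constructor
      · rintro ⟨h1, h2⟩; constructor <;> linarith
      · rintro ⟨h1, h2⟩; constructor <;> linarith
    simp only [this, Set.indicator]
  have hc : Continuous (fun v => Real.exp v * Real.exp (-Real.exp v) / Real.log 2) := by fun_prop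
  rw [e1, lintegral_indicator measurableSet_Ioc, ← ofReal_integral_eq_lintegral_ofReal]
  · congr 1
    rw [← intervalIntegral.integral_of_le (by linarith), intervalIntegral.integral_div,
      intervalIntegral.integral_eq_sub_of_hasDerivAt (fun v _ => G_deriv v)
        (Continuous.intervalIntegrable (by fun_prop) _ _)]
    rw [Real.exp_add, Real.exp_log (by norm_num), Gk]
    ring_nf
  · exact (hc.integrableOn_Icc).mono_set Set.Ioc_subset_Icc_self
  · exact Eventually.of_forall fun v => by positivity

lemma Gk_pos (u : ℝ) : 0 < Gk u := by
  unfold Gk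
  have := Real.exp_lt_exp.mpr (show -(2 * Real.exp u) < -Real.exp u by linarith [Real.exp_pos u])
  linarith

lemma Gk_bd (u : ℝ) : Gk u ≤ Real.exp (-1 * |u|) := by
  unfold Gk
  set x := Real.exp u with hx
  have hx0 : 0 < x := Real.exp_pos u
  have e2 : Real.exp (-(2 * x)) = Real.exp (-x) * Real.exp (-x) := by
    rw [← Real.exp_add]; ring_nf
  have h0 := Real.exp_pos (-x)
  have h1 : Real.exp (-x) ≤ 1 := Real.exp_le_one_iff.mpr (by linarith)
  rcases le_total u 0 with h | h
  · rw [abs_of_nonpos h]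
    have e : Real.exp (-1 * -u) = x := by simp [hx]
    rw [e, e2]
    have := Real.one_sub_le_exp_neg x
    nlinarith
  · rw [abs_of_nonneg h]
    have e : Real.exp (-1 * u) = x⁻¹ := by simp [hx, Real.exp_neg]
    have h3 : Real.exp (-x) ≤ x⁻¹ := by
      rw [Real.exp_neg]
      apply inv_anti₀ hx0
      linarith [Real.add_one_le_exp x]
    rw [e, e2]; nlinarith

theorem stmt9
    (p : ℕ → ℝ) (hp0 : ∀ k, 0 ≤ p k) (hp1 : ∑' k, p k = 1)
    (hpinf : {k | 0 < p k}.Infinite)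
    (β : ℝ) (hβ : 0 ≤ β)
    (ℓ : ℝ → ℝ) (hℓpos : ∀ x > 0, 0 < ℓ x)
    (hℓsv : ∀ c > 0, Tendsto (fun x => ℓ (c * x) / ℓ x) atTop (𝓝 1))
    (h6 : ∀ lam > 0, Tendsto
      (fun t => (rhoJ p 1 (lam * t) - rhoJ p 1 t) / (Real.log t ^ β * ℓ (Real.log t)))
      atTop (𝓝 (Real.log lam)))
    (h60 : β = 0 → (∃ x₀, MonotoneOn ℓ (Set.Ici x₀)) ∧ Tendsto ℓ atTop atTop)
    (j : ℕ) (hj : 1 ≤ j) (a : ℝ) (ha : 0 < a) :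
    Tendsto
      (fun t => (∑' r : Fin j → ℕ,
          if prodP p j r = 0 then (0 : ℝ)
          else Real.exp (-a * |t + Real.log (prodP p j r)|)) /
        (2 / (a * Real.log 2) * (PhiJ p j (2 * Real.exp t) - PhiJ p j (Real.exp t))))
      atTop (𝓝 1) := by
  have hl2 : 0 < Real.log 2 := Real.log_pos (by norm_num)
  have hs : Summable p := by
    by_contra h
    rw [tsum_eq_zero_of_not_summable h] at hp1
    norm_num at hp1
  have hple : ∀ k, p k ≤ 1 := fun k => hp1 ▸ hs.le_tsum k (fun i _ => hp0 i)
  set N := cnt p with hN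
  set f : ℝ → ℝ := fun s => s ^ β * ℓ s with hf
  have hfpos : ∀ᶠ s in atTop, 0 < f s := by
    filter_upwards [eventually_gt_atTop 0] with s hs
    exact mul_pos (Real.rpow_pos_of_pos hs _) (hℓpos s hs)
  have h7 : ∀ h, Tendsto (fun s => (N (s + h) - N s) / f s) atTop (𝓝 h) := by
    intro h
    have := (h6 (Real.exp h) (Real.exp_pos h)).comp Real.tendsto_exp_atTop
    rw [Real.log_exp] at this
    refine this.congr fun s => ?_
    simp only [Function.comp, Real.log_exp, ← Real.exp_add, rho_cnt, hN, hf]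
    rw [add_comm h s]
  have hFpos : ∀ᶠ s in atTop, 0 < N (s + 1) - N s := by
    filter_upwards [hfpos, (h7 1).eventually (lt_mem_nhds one_pos)] with s h1 h2
    by_contra h
    exact absurd h2 (not_lt.mpr (div_nonpos_of_nonpos_of_nonneg (not_lt.mp h) h1.le))
  have hF : ∀ᶠ s in atTop, 1 ≤ N (s + 1) - N s := by
    filter_upwards [hFpos] with s h1
    simp only [hN, cnt] at h1 ⊢
    rw [sub_pos, Nat.cast_lt] at h1
    rw [le_sub_iff_add_le, add_comm]
    exact_mod_cast h1
  have hlim : ∀ h, Tendsto (fun s => (N (s + h) - N s) / (N (s + 1) - N s)) atTop (𝓝 h) := by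
    intro h
    have := (h7 h).div (h7 1) one_ne_zero
    rw [div_one] at this
    refine this.congr' ?_
    filter_upwards [hfpos, hFpos] with s h1 h2
    simp only [Pi.div_apply]
    field_simp
  have hFs : ∀ s, Tendsto (fun t => (N (t + s + 1) - N (t + s)) / (N (t + 1) - N t))
      atTop (𝓝 1) := by
    intro s
    have := (hlim (s + 1)).sub (hlim s)
    rw [add_sub_cancel_left] at this
    refine this.congr fun t => ?_
    rw [← sub_div, add_assoc]; ring_nf
  set F : ℝ → ℝ≥0∞ := fun t => ENNReal.ofReal (N (t + 1) - N t) with hFdef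
  have hE : ∀ a > 0, Kern p F (fun u => ENNReal.ofReal (a / 2) * Ek a u) := by
    intro a ha
    refine kern_layer hp0 hs hlim hF (h := fun v => a ^ 2 / 4 * Real.exp (-a * |v|))
      (α := fun v => |v|) (γ := fun v => -|v|) (by fun_prop) (by fun_prop)
      (by fun_prop) (fun v => by positivity) (b := a) (C := a ^ 2 / 4) ha
      (fun v => le_rfl) (fun v => by simp) (fun v => by simp)
      (fun v => by linarith [abs_nonneg v]) (E_total ha) _ (E_layer ha)
      ⟨a, ha, a / 2, by positivity, fun u => ?_⟩
    rw [Ek, ← ENNReal.ofReal_mul (by positivity)]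
  have hG : Kern p F (fun u => ENNReal.ofReal (Gk u / Real.log 2)) := by
    refine kern_layer hp0 hs hlim hF
      (h := fun v => Real.exp v * Real.exp (-Real.exp v) / Real.log 2)
      (α := fun v => Real.log 2 - v) (γ := fun v => -v) (by fun_prop) (by fun_prop)
      (by fun_prop) (fun v => by positivity) (b := 1) (C := 2 / Real.log 2) one_pos
      (fun v => ?_) (fun v => ?_) (fun v => by simp)
      (fun v => by linarith) ?_ _ G_layer
      ⟨1, one_pos, 1 / Real.log 2, by positivity, fun u => ?_⟩
    · rw [div_mul_eq_mul_div]
      exact div_le_div_of_nonneg_right (G_bd v) hl2.le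
    · have : Real.log 2 ≤ 1 := by linarith [Real.log_two_lt_d9]
      calc |Real.log 2 - v| ≤ |Real.log 2| + |v| := abs_sub _ _
        _ ≤ _ := by rw [abs_of_pos hl2]; linarith
    · rw [← G_total]
      refine integral_congr_ae (Eventually.of_forall fun v => ?_)
      simp only
      field_simp
      ring
    · apply ENNReal.ofReal_le_ofReal
      rw [div_mul_eq_mul_div, one_mul]
      gcongr
      exact Gk_bd u
  have hF1 : ∀ s, Lsim (fun t => F (t + s)) F := fun s =>
    (Lsim_of_tendsto hFpos (hFs s)).1
  have hF2 : ∀ s, Lsim F (fun t => F (t + s)) := fun s =>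
    (Lsim_of_tendsto hFpos (hFs s)).2
  obtain ⟨i, rfl⟩ : ∃ i, j = i + 1 := ⟨j - 1, by omega⟩
  have hmain := main_ind hp0 hple hpinf (F := F) (fun t => ENNReal.ofReal_ne_top) hF1 hF2 hE i
  have hEG := hmain _ _ (hE a ha) hG
  have hGE := hmain _ _ hG (hE a ha)
  set X := (Aop p)^[i+1] (fun u => ENNReal.ofReal (a / 2) * Ek a u) with hX
  set Y := (Aop p)^[i+1] (fun u => ENNReal.ofReal (Gk u / Real.log 2)) with hY
  -- finiteness
  have hfin : ∀ δ > 0, ∀ t,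
      (Aop p)^[i+1] (fun u => ENNReal.ofReal (Real.exp (δ * u))) t ≠ ⊤ := by
    intro δ hδ t
    obtain ⟨t0, h1, h2⟩ := (((hE δ hδ).up 2 (by norm_num)).and (eventually_ge_atTop 0)).exists
    have hne : Aop p (Ek δ) t0 ≠ ⊤ := by
      intro h
      have e : Aop p (fun u => ENNReal.ofReal (δ / 2) * Ek δ u) t0
          = ENNReal.ofReal (δ / 2) * Aop p (Ek δ) t0 := Aop_iter_smul p _ _ 1 t0
      rw [e, h, ENNReal.mul_top (by simpa using hδ)] at h1
      exact (ENNReal.mul_ne_top ENNReal.ofReal_ne_top ENNReal.ofReal_ne_top) (top_le_iff.mp h1)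
    obtain ⟨Z, hZ, hZb⟩ := exp_sum_fin hp0 hple hδ h2 hne
    exact exp_iter_fin hZ hZb _ t
  have hfinK : ∀ K : ℝ → ℝ≥0∞, Kern p F K → ∀ t, (Aop p)^[i+1] K t ≠ ⊤ := by
    intro K hK t
    obtain ⟨δ, hδ, C, hC, hb⟩ := hK.bd
    refine ne_top_of_le_ne_top (ENNReal.mul_ne_top (ENNReal.ofReal_ne_top (r := C)) (hfin δ hδ t)) ?_
    rw [← Aop_iter_smul]
    refine Aop_iter_mono p (fun u => (hb u).trans ?_) _ t
    rw [← ENNReal.ofReal_mul hC.le]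
    apply ENNReal.ofReal_le_ofReal
    refine mul_le_mul_of_nonneg_left (Real.exp_le_exp.mpr ?_) hC.le
    nlinarith [neg_abs_le u]
  have hXfin : ∀ t, X t ≠ ⊤ := hfinK _ (hE a ha)
  have hYfin : ∀ t, Y t ≠ ⊤ := hfinK _ hG
  -- positivity
  obtain ⟨k0, hk0⟩ := hpinf.nonempty
  have hYpos : ∀ t, 0 < (Y t).toReal := by
    intro t
    refine ENNReal.toReal_pos ?_ (hYfin t)
    rw [hY, Aop_iter]
    intro h
    rw [ENNReal.tsum_eq_zero] at h
    have h1 := h (fun _ => k0)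
    have h2 : prodP p (i+1) (fun _ => k0) ≠ 0 := by
      have : 0 < p k0 := hk0
      simp [prodP, this.ne']
    rw [if_neg h2, ENNReal.ofReal_eq_zero] at h1
    have := div_pos (Gk_pos (t + Real.log (prodP p (i+1) (fun _ => k0)))) hl2
    linarith
  -- the numerator
  have hnum : ∀ t, (∑' r : Fin (i+1) → ℕ,
          if prodP p (i+1) r = 0 then (0 : ℝ)
          else Real.exp (-a * |t + Real.log (prodP p (i+1) r)|)) = 2 / a * (X t).toReal := by
    intro t
    rw [hX, Aop_iter_smul, ENNReal.toReal_mul, ENNReal.toReal_ofReal (by positivity), Aop_iter,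
      ENNReal.tsum_toReal_eq]
    · rw [← mul_assoc, show 2 / a * (a / 2) = 1 by field_simp, one_mul]
      refine tsum_congr fun r => ?_
      split_ifs
      · simp
      · rw [Ek, ENNReal.toReal_ofReal (Real.exp_pos _).le]
    · intro r
      split_ifs
      · simp
      · exact ENNReal.ofReal_ne_top
  have hpr0 : ∀ r, 0 ≤ prodP p (i+1) r := fun r => Finset.prod_nonneg fun _ _ => hp0 _
  have hprs : Summable (prodP p (i+1)) := by
    have h1 := hfin 1 one_pos 0
    rw [Aop_iter] at h1
    have h2 := ENNReal.summable_toReal h1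
    refine h2.congr fun r => ?_
    split_ifs with h
    · simp [h]
    · rw [zero_add, one_mul, Real.exp_log (lt_of_le_of_ne (hpr0 r) (Ne.symm h)),
        ENNReal.toReal_ofReal (hpr0 r)]
  have hPhis : ∀ x, 0 ≤ x → Summable (fun r => 1 - Real.exp (-x * prodP p (i+1) r)) := by
    intro x hx
    refine Summable.of_nonneg_of_le (fun r => ?_) (fun r => ?_) (hprs.mul_left x)
    · have : Real.exp (-x * prodP p (i+1) r) ≤ 1 :=
        Real.exp_le_one_iff.mpr (by nlinarith [hpr0 r, mul_nonneg hx (hpr0 r)])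
      linarith
    · have := Real.one_sub_le_exp_neg (x * prodP p (i+1) r)
      rw [neg_mul]; linarith
  have hden : ∀ t, PhiJ p (i+1) (2 * Real.exp t) - PhiJ p (i+1) (Real.exp t)
      = Real.log 2 * (Y t).toReal := by
    intro t
    unfold PhiJ
    rw [← (hPhis _ (by positivity)).tsum_sub (hPhis _ (Real.exp_pos t).le), hY, Aop_iter,
      ENNReal.tsum_toReal_eq, ← tsum_mul_left]
    · refine tsum_congr fun r => ?_
      split_ifs with h
      · simp [h]
      · rw [ENNReal.toReal_ofReal (div_pos (Gk_pos _) hl2).le, mul_div_cancel₀ _ hl2.ne', Gk,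
          Real.exp_add, Real.exp_log (lt_of_le_of_ne (hpr0 r) (Ne.symm h))]
        ring_nf
    · intro r
      split_ifs
      · simp
      · exact ENNReal.ofReal_ne_top
  have hgoal : ∀ t, (∑' r : Fin (i+1) → ℕ,
          if prodP p (i+1) r = 0 then (0 : ℝ)
          else Real.exp (-a * |t + Real.log (prodP p (i+1) r)|)) /
        (2 / (a * Real.log 2) * (PhiJ p (i+1) (2 * Real.exp t) - PhiJ p (i+1) (Real.exp t)))
        = (X t).toReal / (Y t).toReal := by
    intro t
    rw [hnum, hden]
    have := (hYpos t).ne'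
    field_simp
  simp_rw [hgoal]
  have toR : ∀ (U V : ℝ≥0∞) (c : ℝ), 0 ≤ c → V ≠ ⊤ → U ≤ ENNReal.ofReal c * V →
      U.toReal ≤ c * V.toReal := by
    intro U V c hc hV h
    have := ENNReal.toReal_mono (ENNReal.mul_ne_top ENNReal.ofReal_ne_top hV) h
    rwa [ENNReal.toReal_mul, ENNReal.toReal_ofReal hc] at this
  rw [tendsto_order]
  constructor
  · intro b hb
    -- choose c > 1 with b * c < 1
    have hc : ∃ c : ℝ, 1 < c ∧ b * c < 1 := by
      rcases le_or_gt b 0 with h | h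
      · exact ⟨2, by norm_num, by linarith⟩
      · obtain ⟨c, h1, h2⟩ := exists_between ((one_lt_inv₀ h).mpr hb)
        refine ⟨c, h1, ?_⟩
        calc b * c < b * b⁻¹ := by gcongr
          _ = 1 := mul_inv_cancel₀ h.ne'
    obtain ⟨c, hc1, hc2⟩ := hc
    filter_upwards [hGE c hc1] with t ht
    have h1 := toR _ _ c (by linarith) (hXfin t) ht
    have hy := hYpos t
    rw [lt_div_iff₀ hy]
    have hx : 0 < (X t).toReal := by
      by_contra h
      nlinarith [not_lt.mp h]
    rcases le_or_gt b 0 with h | h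
    · nlinarith
    · nlinarith
  · intro b hb
    obtain ⟨c, hc1, hc2⟩ := exists_between hb
    filter_upwards [hEG c hc1] with t ht
    have h1 := toR _ _ c (by linarith) (hYfin t) ht
    have hy := hYpos t
    rw [div_lt_iff₀ hy]
    nlinarith
end

section
/- Let (p_k)_{k∈ℕ} be a probability distribution on ℕ with p_k > 0 for infinitely many k and with (p_k) eventually nonincreasing, and let ρ(x) := #{k ∈ ℕ : p_k ≥ 1/x}. Let β ≥ 0 and let ℓ be slowly varying at ∞; set ℓ₀(x) := (ℓ(x)/(β+1))^{1/(β+1)} and let ℓ₀# be a slowly varying de Bruijn conjugate of ℓ₀ (i.e., ℓ₀(x) ℓ₀#(x ℓ₀(x)) → 1 as x → ∞). Assume: (i) −log p_{⌊x⌋} ~ x^{1/(β+1)} ℓ₀#(x^{1/(β+1)}) as x → ∞; (ii) with s(x) := 1/p_{⌊x⌋} for x ≥ 1, for every u ∈ ℝ, lim_{t→∞} s(t + u g(t))/s(t) = e^u, where g is a nonnegative measurable function with g(t) ~ (β+1)^{β/(β+1)} t^{β/(β+1)} (ℓ(t^{1/(β+1)}))^{1/(β+1)} as t → ∞; (iii)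 ℓ(t (ℓ(t))^{1/(β+1)}) ~ ℓ(t) as t → ∞. Then for every λ > 0, lim_{t→∞} (ρ(λt) − ρ(t))/((log t)^β ℓ(log t)) = log λ. -/
open Filter Topology
/-- Counting function of the probabilities: `ρ(x) = #{k : p_k ≥ 1/x}` (as a real number). -/
noncomputable def rhoFn (p : ℕ → ℝ) (x : ℝ) : ℝ := (Nat.card {k : ℕ // 1 / x ≤ p k} : ℝ)

/-- Uniform convergence theorem, additive form. -/
lemma uct_aux (L H : ℝ → ℝ) (hH : Measurable H)
    (hLH : Tendsto (fun x => L x - H x) atTop (𝓝 0))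
    (hL : ∀ u : ℝ, Tendsto (fun x => L (x + u) - L x) atTop (𝓝 0)) (ε : ℝ) (hε : 0 < ε) :
    ∃ X : ℝ, ∀ x ≥ X, ∀ u ∈ Set.Icc (0:ℝ) 1, |L (x + u) - L x| < ε := by
  have hHu : ∀ u : ℝ, Tendsto (fun x => H (x + u) - H x) atTop (𝓝 0) := by
    intro u
    have h1 := hLH.comp (tendsto_atTop_add_const_right atTop u tendsto_id)
    have h2 := ((hL u).sub h1).add hLH
    simp only [sub_zero, add_zero] at h2
    refine h2.congr fun x => ?_
    simp only [Function.comp, id]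
    ring
  by_contra! hcon
  choose x hx u hu hxu using fun n : ℕ => hcon (n:ℝ)
  have hxt : Tendsto x atTop atTop := tendsto_atTop_mono hx tendsto_natCast_atTop_atTop
  have hyt : Tendsto (fun n => x n + u n) atTop atTop :=
    tendsto_atTop_mono (fun n => le_add_of_nonneg_right (hu n).1) hxt
  -- convergence in measure on [0,2]
  let μ : MeasureTheory.Measure ℝ := MeasureTheory.volume.restrict (Set.Icc 0 2)
  have key : ∀ z : ℕ → ℝ, Tendsto z atTop atTop →
      Tendsto (fun n => μ {v | ε / 4 ≤ dist (H (z n + v) - H (z n)) 0}) atTop (𝓝 0) := by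
    intro z hz
    have h := MeasureTheory.tendstoInMeasure_of_tendsto_ae (μ := μ)
      (f := fun n v => H (z n + v) - H (z n)) (g := fun _ => (0:ℝ))
      (fun n => ((hH.comp (measurable_const_add (z n))).sub_const _).aestronglyMeasurable)
      (Eventually.of_forall fun v => (hHu v).comp hz)
    rw [MeasureTheory.tendstoInMeasure_iff_dist] at h
    exact h (ε/4) (by positivity)
  have e1 := (key x hxt).eventually (gt_mem_nhds (show (0:ENNReal) < 1/4 by norm_num))
  have e2 := (key _ hyt).eventually (gt_mem_nhds (show (0:ENNReal) < 1/4 by norm_num))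
  have e3 := (hLH.comp hxt).eventually (Metric.ball_mem_nhds 0 (show 0 < ε/4 by positivity))
  have e4 := (hLH.comp hyt).eventually (Metric.ball_mem_nhds 0 (show 0 < ε/4 by positivity))
  obtain ⟨n, h1, h2, h3, h4⟩ := (e1.and (e2.and (e3.and e4))).exists
  set A := {v | ε / 4 ≤ dist (H (x n + v) - H (x n)) 0} with hA
  set B := {v | ε / 4 ≤ dist (H (x n + u n + v) - H (x n + u n)) 0} with hB
  have hmA : MeasurableSet A := by
    apply measurableSet_le measurable_const
    exact (((hH.comp (measurable_const_add (x n))).sub_const _)).dist measurable_const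
  have hmB : MeasurableSet B := by
    apply measurableSet_le measurable_const
    exact (((hH.comp (measurable_const_add (x n + u n))).sub_const _)).dist measurable_const
  have hex : ∃ v ∈ Set.Icc (u n) (u n + 1), v ∉ A ∧ v - u n ∉ B := by
    by_contra! hno
    have hsub : Set.Icc (u n) (u n + 1) ⊆ (A ∩ Set.Icc 0 2) ∪ (fun v => v + (-u n)) ⁻¹' (B ∩ Set.Icc 0 2) := by
      intro v hv
      have := hno v hv
      have hun := hu n
      by_cases hvA : v ∈ A
      · left
        exact ⟨hvA, by linarith [hv.1, hun.1], by linarith [hv.2, hun.2]⟩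
      · right
        refine ⟨this hvA, ?_, ?_⟩
        · show 0 ≤ v + -u n
          linarith [hv.1]
        · show v + -u n ≤ 2
          linarith [hv.2]
    have hm := (MeasureTheory.measure_mono (μ := MeasureTheory.volume) hsub).trans
      (MeasureTheory.measure_union_le _ _)
    rw [MeasureTheory.measure_preimage_add_right, Real.volume_Icc] at hm
    rw [MeasureTheory.Measure.restrict_apply hmA] at h1
    rw [MeasureTheory.Measure.restrict_apply hmB] at h2
    have hlt := hm.trans_lt (ENNReal.add_lt_add h1 h2)
    have : (1/4 + 1/4 : ENNReal) = ENNReal.ofReal (1/2) := by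
      rw [← ENNReal.ofReal_one, show (4:ENNReal) = ENNReal.ofReal 4 by simp,
        ← ENNReal.ofReal_div_of_pos (by norm_num), ← ENNReal.ofReal_add (by norm_num) (by norm_num)]
      norm_num
    rw [this, ENNReal.ofReal_lt_ofReal_iff (by norm_num)] at hlt
    linarith
  obtain ⟨v, hv, hvA, hvB⟩ := hex
  simp only [hA, hB, Set.mem_ofPred_eq, not_le, Real.dist_eq, sub_zero] at hvA hvB
  rw [show x n + u n + (v - u n) = x n + v by ring] at hvB
  simp only [Function.comp, Metric.mem_ball, Real.dist_eq, sub_zero] at h3 h4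
  have := hxu n
  rw [abs_lt] at hvA hvB h3 h4
  rw [le_abs] at this
  rcases this with h | h <;> linarith [hvA.1, hvA.2, hvB.1, hvB.2, h3.1, h3.2, h4.1, h4.2]

/-- linear lower bound -/
lemma uct_lower (L : ℝ → ℝ) (ε X : ℝ)
    (h : ∀ x ≥ X, ∀ u ∈ Set.Icc (0:ℝ) 1, |L (x + u) - L x| < ε) :
    ∀ n : ℕ, ∀ x, X + n ≤ x → x ≤ X + n + 1 → L X - ε * (n + 1) ≤ L x := by
  intro n
  induction n with
  | zero =>
    intro x h1 h2
    simp only [Nat.cast_zero, add_zero] at h1 h2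
    have := h X le_rfl (x - X) ⟨by linarith, by linarith⟩
    rw [abs_lt, add_sub_cancel] at this
    simp; linarith [this.1]
  | succ k ih =>
    intro x h1 h2
    push_cast at h1 h2
    have h3 := ih (x - 1) (by linarith) (by linarith)
    have := h (x - 1) (by have : (0:ℝ) ≤ k := k.cast_nonneg
                          linarith) 1 ⟨by norm_num, by norm_num⟩
    rw [abs_lt, sub_add_cancel] at this
    push_cast
    linarith [this.1]

lemma uct_grow (L : ℝ → ℝ) (hU : ∀ ε > 0, ∃ X : ℝ, ∀ x ≥ X, ∀ u ∈ Set.Icc (0:ℝ) 1, |L (x + u) - L x| < ε)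
    (a : ℝ) (ha : 0 < a) : Tendsto (fun x => x + a * L x) atTop atTop := by
  obtain ⟨X, hX⟩ := hU (1 / (2 * a)) (by positivity)
  have hl := uct_lower L _ X hX
  have : ∀ᶠ x in atTop, x + a * (L X - 1/(2*a) * (x - X + 1)) ≤ x + a * L x := by
    filter_upwards [eventually_ge_atTop X] with x hx
    have h0 : (0:ℝ) ≤ x - X := by linarith
    have h1 := Nat.floor_le h0
    have h2 := (Nat.lt_floor_add_one (x - X)).le
    have h3 := hl ⌊x - X⌋₊ x (by linarith) (by linarith)
    have h4 : L X - 1/(2*a) * (x - X + 1) ≤ L x := by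
      refine le_trans ?_ h3
      have : 1/(2*a) * (⌊x - X⌋₊ + 1) ≤ 1/(2*a) * (x - X + 1) := by gcongr
      linarith
    have := mul_le_mul_of_nonneg_left h4 ha.le
    linarith
  refine tendsto_atTop_mono' _ this ?_
  have h5 : (fun x => x + a * (L X - 1/(2*a) * (x - X + 1))) = fun x => (1/2) * x + (a * L X + X/2 - 1/2) := by
    funext x; field_simp; ring
  rw [h5]
  exact tendsto_atTop_add_const_right _ _ (tendsto_id.const_mul_atTop (by norm_num))

/-- multiplicative consequences -/
lemma sv_uniform (ℓ h : ℝ → ℝ) (hpos : ∀ x > 0, 0 < ℓ x) (hm : Measurable h)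
    (hsv : ∀ c > 0, Tendsto (fun x => ℓ (c * x) / ℓ x) atTop (𝓝 1))
    (hh : Tendsto (fun x => h x / ℓ x) atTop (𝓝 1)) :
    (∀ a : ℝ, 0 < a → Tendsto (fun x => x * ℓ x ^ a) atTop atTop) ∧
    (∀ y z : ℝ → ℝ, Tendsto y atTop atTop → Tendsto z atTop atTop →
      Tendsto (fun t => y t / z t) atTop (𝓝 1) →
      Tendsto (fun t => ℓ (y t) / ℓ (z t)) atTop (𝓝 1)) := by
  have hlog : Tendsto Real.log (𝓝 1) (𝓝 0) := by
    have := (Real.continuousAt_log one_ne_zero).tendsto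
    simpa using this
  set L : ℝ → ℝ := fun x => Real.log (ℓ (Real.exp x)) with hLdef
  have hU : ∀ ε > 0, ∃ X : ℝ, ∀ x ≥ X, ∀ u ∈ Set.Icc (0:ℝ) 1, |L (x + u) - L x| < ε := by
    intro ε hε
    refine uct_aux L (fun x => Real.log (h (Real.exp x)))
      (Real.measurable_log.comp (hm.comp Real.measurable_exp)) ?_ ?_ ε hε
    · have h1 := (hlog.comp (hh.comp Real.tendsto_exp_atTop)).neg
      rw [neg_zero] at h1
      have h2 := (hh.comp Real.tendsto_exp_atTop).eventually (lt_mem_nhds zero_lt_one)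
      refine h1.congr' ?_
      filter_upwards [h2] with x hx
      have hp := hpos _ (Real.exp_pos x)
      simp only [Function.comp] at hx ⊢
      have hq : 0 < h (Real.exp x) := by
        by_contra hc
        exact absurd hx (not_lt.2 (div_nonpos_of_nonpos_of_nonneg (not_lt.1 hc) hp.le))
      rw [Real.log_div hq.ne' hp.ne']; simp only [hLdef]; ring
    · intro u
      have h1 := hlog.comp ((hsv (Real.exp u) (Real.exp_pos u)).comp Real.tendsto_exp_atTop)
      refine h1.congr fun x => ?_
      simp only [Function.comp, hLdef]
      rw [Real.log_div (hpos _ (by positivity)).ne' (hpos _ (by positivity)).ne', Real.exp_add, mul_comm]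
  constructor
  · intro a ha
    have h1 := (Real.tendsto_exp_atTop.comp (uct_grow L hU a ha)).comp Real.tendsto_log_atTop
    refine h1.congr' ?_
    filter_upwards [eventually_gt_atTop 0] with x hx
    simp only [Function.comp, hLdef]
    rw [Real.exp_add, Real.exp_log hx, Real.rpow_def_of_pos (hpos x hx), mul_comm a]
  · intro y z hy hz hyz
    have hd := hlog.comp hyz
    have : Tendsto (fun t => L (Real.log (y t)) - L (Real.log (z t))) atTop (𝓝 0) := by
      rw [Metric.tendsto_nhds]
      intro ε hε
      obtain ⟨X, hX⟩ := hU ε hε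
      filter_upwards [(Real.tendsto_log_atTop.comp hy).eventually_ge_atTop X,
        (Real.tendsto_log_atTop.comp hz).eventually_ge_atTop X,
        hd.eventually (Metric.ball_mem_nhds 0 one_pos), hy.eventually_gt_atTop 0,
        hz.eventually_gt_atTop 0] with t h1 h2 h3 h4 h5
      simp only [Function.comp, Metric.mem_ball, Real.dist_eq, sub_zero] at *
      rw [Real.log_div h4.ne' h5.ne', abs_lt] at h3
      rcases le_total (Real.log (z t)) (Real.log (y t)) with h | h
      · have := hX _ h2 (Real.log (y t) - Real.log (z t)) ⟨by linarith, by linarith⟩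
        rwa [add_sub_cancel] at this
      · have := hX _ h1 (Real.log (z t) - Real.log (y t)) ⟨by linarith, by linarith⟩
        rwa [add_sub_cancel, abs_sub_comm] at this
    have h6 := (Real.continuous_exp.tendsto 0).comp this
    rw [Real.exp_zero] at h6
    refine h6.congr' ?_
    filter_upwards [hy.eventually_gt_atTop 0, hz.eventually_gt_atTop 0] with t h4 h5
    simp only [Function.comp, hLdef]
    rw [Real.exp_log h4, Real.exp_log h5, ← Real.log_div (hpos _ h4).ne' (hpos _ h5).ne',
      Real.exp_log (div_pos (hpos _ h4) (hpos _ h5))]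

/-- asymptotic injectivity for monotone functions, regularly varying of index one -/
lemma asymp_inj (M : ℝ → ℝ) (Y : ℝ) (hmono : ∀ x ≥ Y, ∀ x' ≥ x, M x ≤ M x')
    (hpos : ∀ᶠ x in atTop, 0 < M x)
    (hrv : ∀ c > 0, Tendsto (fun x => M (c * x) / M x) atTop (𝓝 c))
    (y z : ℝ → ℝ) (hy : Tendsto y atTop atTop) (hz : Tendsto z atTop atTop)
    (hyz : Tendsto (fun t => M (y t) / M (z t)) atTop (𝓝 1)) :
    Tendsto (fun t => y t / z t) atTop (𝓝 1) := by
  rw [tendsto_order]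
  constructor
  · intro c hc
    have hc' : max c (1/2) < 1 := max_lt hc (by norm_num)
    have hc0 : 0 < max c (1/2) := lt_max_of_lt_right (by norm_num)
    obtain ⟨d, hd1, hd2⟩ := exists_between hc'
    filter_upwards [hy.eventually_ge_atTop Y, hz.eventually hpos, hz.eventually_gt_atTop 0,
      ((hrv _ hc0).comp hz).eventually (gt_mem_nhds hd1), hyz.eventually (lt_mem_nhds hd2)]
      with t h1 h2 h3 h4 h5
    by_contra! hcon
    rw [div_le_iff₀ h3] at hcon
    have h6 : y t ≤ max c (1/2) * z t := hcon.trans (by gcongr; exact le_max_left _ _)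
    have h7 := hmono _ h1 _ h6
    have h8 : M (y t) / M (z t) ≤ M (max c (1/2) * z t) / M (z t) := by gcongr
    simp only [Function.comp] at h4
    linarith
  · intro c hc
    obtain ⟨d, hd1, hd2⟩ := exists_between hc
    filter_upwards [(hz.const_mul_atTop (zero_lt_one.trans hc)).eventually_ge_atTop Y,
      hz.eventually hpos, hz.eventually_gt_atTop 0,
      ((hrv _ (zero_lt_one.trans hc)).comp hz).eventually (lt_mem_nhds hd2),
      hyz.eventually (gt_mem_nhds hd1)]
      with t h1 h2 h3 h4 h5
    by_contra! hcon
    rw [le_div_iff₀ h3] at hcon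
    have h7 := hmono _ h1 _ hcon
    have h8 : M (c * z t) / M (z t) ≤ M (y t) / M (z t) := by gcongr
    simp only [Function.comp] at h4
    linarith

lemma rho_count (p : ℕ → ℝ) (hp0 : ∀ k, 0 ≤ p k) (hpt : Tendsto p atTop (𝓝 0)) (k₀ : ℕ)
    (hmono : ∀ m n : ℕ, k₀ ≤ m → m ≤ n → p n ≤ p m) :
    ∃ N : ℝ → ℕ, ∃ d : ℕ, (∀ t > 0, ∀ k ≥ k₀, k < N t ↔ 1 / t ≤ p k) ∧ (∀ t > 0, k₀ ≤ N t) ∧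
      ∀ᶠ t in atTop, rhoFn p t = (N t : ℝ) - d := by
  classical
  have hne : ∀ t > 0, {k | k₀ ≤ k ∧ p k < 1 / t}.Nonempty := by
    intro t ht
    obtain ⟨k, h1, h2⟩ := ((hpt.eventually (gt_mem_nhds (show (0:ℝ) < 1 / t by positivity))).and
      (eventually_ge_atTop k₀)).exists
    exact ⟨k, h2, h1⟩
  set N : ℝ → ℕ := fun t => sInf {k | k₀ ≤ k ∧ p k < 1 / t} with hN
  have hmem : ∀ t > 0, k₀ ≤ N t ∧ p (N t) < 1 / t := fun t ht => Nat.sInf_mem (hne t ht)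
  have hchar : ∀ t > 0, ∀ k ≥ k₀, k < N t ↔ 1 / t ≤ p k := by
    intro t ht k hk
    constructor
    · intro h
      have := Nat.notMem_of_lt_sInf h
      by_contra! hc
      exact this ⟨hk, hc⟩
    · intro h
      by_contra! hc
      have := hmono _ _ (hmem t ht).1 hc
      linarith [(hmem t ht).2]
  refine ⟨N, ((Finset.range k₀).filter fun k => p k = 0).card, hchar,
    fun t ht => (hmem t ht).1, ?_⟩
  have hlarge : ∀ᶠ t : ℝ in atTop, ∀ k ∈ Finset.range k₀, 0 < p k → 1 / t ≤ p k := by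
    rw [Filter.eventually_all_finset]
    intro k _
    by_cases hk : 0 < p k
    · filter_upwards [eventually_ge_atTop (1 / p k), eventually_gt_atTop 0] with t ht ht0 _
      exact (one_div_le ht0 hk).2 ht
    · exact Eventually.of_forall fun t h => absurd h hk
  filter_upwards [hlarge, eventually_gt_atTop 0] with t ht ht0
  have hset : {k : ℕ | 1 / t ≤ p k} =
      ↑((Finset.range (N t)) \ ((Finset.range k₀).filter fun k => p k = 0)) := by
    ext k
    have hpos : 0 < 1 / t := by positivity
    simp only [Set.mem_ofPred_eq, Finset.coe_sdiff, Set.mem_sdiff, Finset.mem_coe, Finset.mem_range,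
      Finset.mem_filter, not_and]
    rcases lt_or_ge k k₀ with h | h
    · constructor
      · intro h1
        exact ⟨h.trans_le (hmem t ht0).1, fun _ => by linarith⟩
      · rintro ⟨_, h2⟩
        exact ht k (Finset.mem_range.2 h) (lt_of_le_of_ne (hp0 k) (Ne.symm (h2 h)))
    · rw [hchar t ht0 k h]
      exact ⟨fun h1 => ⟨h1, fun h2 => absurd h2 (not_lt.2 h)⟩, fun h1 => h1.1⟩
  have hsub : ((Finset.range k₀).filter fun k => p k = 0) ⊆ Finset.range (N t) :=
    (Finset.filter_subset _ _).trans (Finset.range_mono (hmem t ht0).1)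
  have hcard : Nat.card {k : ℕ // 1 / t ≤ p k} =
      ((Finset.range (N t)) \ ((Finset.range k₀).filter fun k => p k = 0)).card := by
    have : Nat.card {k : ℕ // 1 / t ≤ p k} = Set.ncard {k : ℕ | 1 / t ≤ p k} := rfl
    rw [this, hset, Set.ncard_coe_finset]
  rw [rhoFn, hcard, Finset.card_sdiff_of_subset hsub, Nat.cast_sub (Finset.card_le_card hsub),
    Finset.card_range]

lemma core_count (p : ℕ → ℝ) (k₀ : ℕ) (hppos : ∀ k ≥ k₀, 0 < p k)
    (N : ℝ → ℕ) (hN : ∀ t > 0, ∀ k ≥ k₀, k < N t ↔ 1 / t ≤ p k) (hNk : ∀ t > 0, k₀ ≤ N t)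
    (g : ℝ → ℝ) (hg0 : ∀ t, 0 ≤ g t)
    (hii : ∀ u : ℝ, Tendsto (fun t =>
      (1 / p ⌊t + u * g t⌋₊) / (1 / p ⌊t⌋₊)) atTop (𝓝 (Real.exp u))) :
    Tendsto N atTop atTop ∧ Tendsto (fun t => (1 / p (N t)) / t) atTop (𝓝 1) ∧
    (∀ᶠ t in atTop, 0 < g (N t)) ∧
    ∀ lam > 0, Tendsto (fun t => ((N (lam * t) : ℝ) - N t) / g (N t)) atTop
      (𝓝 (Real.log lam)) := by
  have hNt : Tendsto N atTop atTop := by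
    rw [tendsto_atTop]
    intro K
    have h := hppos (max K k₀) (le_max_right _ _)
    filter_upwards [eventually_ge_atTop (1 / p (max K k₀)), eventually_gt_atTop 0] with t ht ht0
    have := (hN t ht0 (max K k₀) (le_max_right _ _)).2 ((one_div_le ht0 h).2 ht)
    exact (le_max_left _ _).trans this.le
  have hNr : Tendsto (fun t => (N t : ℝ)) atTop atTop := tendsto_natCast_atTop_atTop.comp hNt
  have hgt : Tendsto (fun n : ℕ => g n) atTop atTop := by
    rw [tendsto_atTop]
    intro K
    have hK : 0 < max K 1 := lt_max_of_lt_right one_pos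
    have h1 := ((hii (1 / max K 1)).comp tendsto_natCast_atTop_atTop).eventually
      (lt_mem_nhds (Real.one_lt_exp_iff.2 (show 0 < 1 / max K 1 by positivity)))
    filter_upwards [h1, eventually_ge_atTop k₀] with n hn hnk
    by_contra! hc
    have hfl : ⌊(n:ℝ) + 1 / max K 1 * g n⌋₊ = n := by
      rw [Nat.floor_eq_iff (by have := hg0 n; positivity)]
      constructor
      · have := hg0 n
        have : 0 ≤ 1 / max K 1 * g n := by positivity
        linarith
      · have : 1 / max K 1 * g n < 1 := by
          rw [one_div, inv_mul_lt_iff₀ hK, mul_one]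
          exact hc.trans_le (le_max_left _ _)
        linarith
    simp only [Function.comp, hfl, Nat.floor_natCast] at hn
    have := hppos n hnk
    rw [div_self (by positivity)] at hn
    exact lt_irrefl _ hn
  have hgN : Tendsto (fun t => g (N t)) atTop atTop := hgt.comp hNt
  have hsN : ∀ t > 0, t < 1 / p (N t) := by
    intro t ht
    have h := hppos _ (hNk t ht)
    have := (hN t ht (N t) (hNk t ht)).not.1 (lt_irrefl _)
    push Not at this
    exact (lt_one_div ht h).2 this
  have hle : ∀ t > 0, ∀ k ≥ k₀, k < N t ↔ 1 / p k ≤ t := by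
    intro t ht k hk
    rw [hN t ht k hk, one_div_le ht (hppos k hk)]
  set J : ℝ → ℝ → ℕ := fun u t => ⌊(N t : ℝ) + u * g (N t)⌋₊ with hJ
  have hJr : ∀ u, Tendsto (fun t => (1 / p (J u t)) / (1 / p (N t))) atTop (𝓝 (Real.exp u)) := by
    intro u
    have := (hii u).comp hNr
    refine this.congr fun t => ?_
    simp only [Function.comp, Nat.floor_natCast, hJ]
  have hsNt : Tendsto (fun t => 1 / p (N t)) atTop atTop := by
    refine tendsto_atTop_mono' _ ?_ tendsto_id
    filter_upwards [eventually_gt_atTop 0] with t ht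
    exact (hsN t ht).le
  have hJk : ∀ u, ∀ᶠ t in atTop, k₀ ≤ J u t := by
    intro u
    have h1 : Tendsto (fun t => 1 / p (J u t)) atTop atTop := by
      refine ((hJr u).pos_mul_atTop (Real.exp_pos u) hsNt).congr' ?_
      filter_upwards [hsNt.eventually_gt_atTop 0] with t ht
      exact div_mul_cancel₀ _ ht.ne'
    filter_upwards [h1.eventually_gt_atTop (∑ k ∈ Finset.range k₀, |1 / p k|)] with t ht
    by_contra! hc
    have := Finset.single_le_sum (f := fun k => |1 / p k|) (fun k _ => abs_nonneg _)
      (Finset.mem_range.2 hc)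
    have h2 := le_abs_self (1 / p (J u t))
    linarith
  have hC1 : Tendsto (fun t => (1 / p (N t)) / t) atTop (𝓝 1) := by
    rw [tendsto_order]
    constructor
    · intro c hc
      filter_upwards [eventually_gt_atTop 0] with t ht
      refine hc.trans ?_
      rw [one_lt_div ht]
      exact hsN t ht
    · intro c hc
      set ε := Real.log c / 2 with hε
      have hε0 : 0 < ε := by have := Real.log_pos hc; positivity
      have hlt : Real.exp (-(2 * ε)) < Real.exp (-ε) := Real.exp_lt_exp.2 (by linarith)
      filter_upwards [eventually_gt_atTop 0, (hJr (-ε)).eventually (lt_mem_nhds hlt), hJk (-ε),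
        hgN.eventually_ge_atTop (1 / ε), hNr.eventually_ge_atTop 1] with t ht h1 h2 h3 h4
      have hJN : J (-ε) t < N t := by
        have : 1 ≤ ε * g (N t) := by
          rwa [div_le_iff₀ hε0, mul_comm] at h3
        rw [hJ]
        refine (Nat.floor_lt' (by intro h; rw [h] at h4; norm_num at h4)).2 ?_
        linarith
      have h5 := (hle t ht _ h2).1 hJN
      have hs := ht.trans (hsN t ht)
      rw [lt_div_iff₀ hs, Real.exp_neg, hε, mul_div_cancel₀ _ (by norm_num : (2:ℝ) ≠ 0),
        Real.exp_log (by linarith)] at h1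
      rw [div_lt_iff₀ ht]
      have h6 := h1.trans_le h5
      rwa [inv_mul_lt_iff₀ (by linarith)] at h6
  have hJt : ∀ u, Tendsto (fun t => (1 / p (J u t)) / t) atTop (𝓝 (Real.exp u)) := by
    intro u
    have := (hJr u).mul hC1
    rw [mul_one] at this
    refine this.congr' ?_
    filter_upwards [hsNt.eventually_gt_atTop 0] with t ht
    exact div_mul_div_cancel₀ ht.ne'
  refine ⟨hNt, hC1, hgN.eventually_gt_atTop 0, fun lam hlam => ?_⟩
  rw [tendsto_order]
  constructor
  · intro u hu
    have hlt : Real.exp u < lam := by rwa [Real.lt_log_iff_exp_lt hlam] at hu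
    filter_upwards [eventually_gt_atTop 0, (hJt u).eventually (gt_mem_nhds hlt), hJk u,
      hgN.eventually_gt_atTop 0] with t ht h1 h2 h3
    rw [div_lt_iff₀ ht] at h1
    have h4 := (hle (lam * t) (by positivity) _ h2).2 h1.le
    have h5 := Nat.lt_floor_add_one ((N t : ℝ) + u * g (N t))
    have h6 : ((J u t : ℕ) : ℝ) + 1 ≤ N (lam * t) := by exact_mod_cast h4
    rw [lt_div_iff₀ h3]
    simp only [hJ] at h6
    linarith
  · intro u hu
    obtain ⟨v, hv1, hv2⟩ := exists_between hu
    have hlt : lam < Real.exp v := by rwa [Real.log_lt_iff_lt_exp hlam] at hv1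
    filter_upwards [eventually_gt_atTop 0, (hJt v).eventually (lt_mem_nhds hlt), hJk v,
      hgN.eventually_gt_atTop 0, hNr.eventually_ge_atTop 1,
      (hNt.comp (tendsto_id.const_mul_atTop hlam)).eventually_ge_atTop 1] with t ht h1 h2 h3 h4 h7
    rw [lt_div_iff₀ ht] at h1
    have h5 := (hle (lam * t) (by positivity) _ h2).not.2 (not_le.2 h1)
    push Not at h5
    simp only [Function.comp, id] at h7
    have h8 : ((N (lam * t) : ℕ) : ℝ) ≤ (N t : ℝ) + v * g (N t) :=
      (Nat.le_floor_iff' (by omega)).1 h5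
    refine lt_of_le_of_lt ?_ hv2
    rw [div_le_iff₀ h3]
    linarith

theorem stmt17
    (p : ℕ → ℝ) (hp0 : ∀ k, 0 ≤ p k) (hp1 : ∑' k, p k = 1)
    (hpinf : {k | 0 < p k}.Infinite)
    (hpmono : ∃ k₀ : ℕ, ∀ m n : ℕ, k₀ ≤ m → m ≤ n → p n ≤ p m)
    (β : ℝ) (hβ : 0 ≤ β)
    (ℓ : ℝ → ℝ) (hℓpos : ∀ x > 0, 0 < ℓ x)
    (hℓsv : ∀ c > 0, Tendsto (fun x => ℓ (c * x) / ℓ x) atTop (𝓝 1))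
    -- `ℓ₀(x) = (ℓ(x)/(β+1))^{1/(β+1)}` and `ℓ₀#` is a slowly varying de Bruijn conjugate of `ℓ₀`
    (ℓ₀sharp : ℝ → ℝ) (hℓ₀sharppos : ∀ x > 0, 0 < ℓ₀sharp x)
    (hℓ₀sharpsv : ∀ c > 0, Tendsto (fun x => ℓ₀sharp (c * x) / ℓ₀sharp x) atTop (𝓝 1))
    (hconj : Tendsto (fun x =>
      (ℓ x / (β + 1)) ^ (1 / (β + 1)) *
        ℓ₀sharp (x * (ℓ x / (β + 1)) ^ (1 / (β + 1)))) atTop (𝓝 1))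
    -- (i)  `-log p_{⌊x⌋} ~ x^{1/(β+1)} ℓ₀#(x^{1/(β+1)})`
    (hi : Tendsto (fun x =>
      (-Real.log (p ⌊x⌋₊)) / (x ^ (1 / (β + 1)) * ℓ₀sharp (x ^ (1 / (β + 1)))))
      atTop (𝓝 1))
    -- (ii)  with `s(x) = 1/p_{⌊x⌋}`, `s(t + u g(t))/s(t) → e^u`
    (g : ℝ → ℝ) (hg0 : ∀ t, 0 ≤ g t) (hgmeas : Measurable g)
    (hgasymp : Tendsto (fun t =>
      g t / ((β + 1) ^ (β / (β + 1)) * t ^ (β / (β + 1)) *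
        (ℓ (t ^ (1 / (β + 1)))) ^ (1 / (β + 1)))) atTop (𝓝 1))
    (hii : ∀ u : ℝ, Tendsto (fun t =>
      (1 / p ⌊t + u * g t⌋₊) / (1 / p ⌊t⌋₊)) atTop (𝓝 (Real.exp u)))
    -- (iii)  `ℓ(t (ℓ(t))^{1/(β+1)}) ~ ℓ(t)`
    (hiii : Tendsto (fun t => ℓ (t * (ℓ t) ^ (1 / (β + 1))) / ℓ t) atTop (𝓝 1)) :
    ∀ lam > 0, Tendsto
      (fun t => (rhoFn p (lam * t) - rhoFn p t) / (Real.log t ^ β * ℓ (Real.log t)))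
      atTop (𝓝 (Real.log lam)) := by
  intro lam hlam
  obtain ⟨k₀, hmono⟩ := hpmono
  have hb : 0 < β + 1 := by linarith
  have hb0 : β + 1 ≠ 0 := hb.ne'
  set a := 1 / (β + 1) with ha
  have hapos : 0 < a := by positivity
  have hab : a * (β + 1) = 1 := by rw [ha]; field_simp
  have hβa : β / (β + 1) = a * β := by rw [ha]; field_simp
  -- basic facts on p
  have hsum : Summable p := by
    by_contra h
    rw [tsum_eq_zero_of_not_summable h] at hp1
    exact zero_ne_one hp1
  have hpt := hsum.tendsto_atTop_zero
  have hppos : ∀ k ≥ k₀, 0 < p k := by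
    intro k hk
    obtain ⟨n, hn, hkn⟩ := hpinf.exists_gt k
    exact lt_of_lt_of_le hn (hmono k n hk hkn.le)
  obtain ⟨N, d, hN, hNk, hrho⟩ := rho_count p hp0 hpt k₀ hmono
  obtain ⟨hNt, hC1, hgpos, hC2⟩ := core_count p k₀ hppos N hN hNk g hg0 hii
  have hNr : Tendsto (fun t => (N t : ℝ)) atTop atTop := tendsto_natCast_atTop_atTop.comp hNt
  -- uniformity for ℓ
  have hgy : Tendsto (fun y : ℝ => g (y ^ (β + 1)) / ((β + 1) ^ (a * β) * y ^ β * ℓ y ^ a))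
      atTop (𝓝 1) := by
    refine (hgasymp.comp (tendsto_rpow_atTop hb)).congr' ?_
    filter_upwards [eventually_gt_atTop 0] with y hy
    simp only [Function.comp]
    rw [hβa, ← Real.rpow_mul hy.le, ← Real.rpow_mul hy.le, ← mul_assoc, mul_comm (β + 1) a, hab,
      one_mul, Real.rpow_one]
  obtain ⟨hgrow, hunif⟩ := sv_uniform ℓ
    (fun y => (g (y ^ (β + 1)) / ((β + 1) ^ (a * β) * y ^ β)) ^ (β + 1)) hℓpos (by fun_prop) hℓsv (by
      have h1 := hgy.rpow_const (p := β + 1) (Or.inl one_ne_zero)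
      rw [Real.one_rpow] at h1
      refine h1.congr' ?_
      filter_upwards [eventually_gt_atTop 0] with y hy
      have hl := hℓpos y hy
      have := hg0 (y ^ (β + 1))
      rw [← div_div, Real.div_rpow (by positivity) (by positivity), ← Real.rpow_mul hl.le, hab,
        Real.rpow_one])
  -- notation
  set T : ℝ → ℝ := Real.log with hT
  have hTt : Tendsto T atTop atTop := Real.tendsto_log_atTop
  set y : ℝ → ℝ := fun t => (N t : ℝ) ^ a with hy
  have hyt : Tendsto y atTop atTop := (tendsto_rpow_atTop hapos).comp hNr
  set W : ℝ → ℝ := fun t => T t * ℓ (T t) ^ a with hW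
  have hWt : Tendsto W atTop atTop := (hgrow a hapos).comp hTt
  set Z : ℝ → ℝ := fun t => T t * (ℓ (T t) / (β + 1)) ^ a with hZ
  have hZW : ∀ᶠ t in atTop, Z t = ((β + 1) ^ a)⁻¹ * W t := by
    filter_upwards [hTt.eventually_gt_atTop 0] with t ht
    have := hℓpos _ ht
    simp only [hZ, hW]
    rw [Real.div_rpow this.le hb.le]
    ring
  have hba : 0 < ((β + 1) ^ a)⁻¹ := by positivity
  have hZt : Tendsto Z atTop atTop :=
    (tendsto_congr' hZW).2 (hWt.const_mul_atTop hba)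
  have hℓZ : Tendsto (fun t => ℓ (Z t) / ℓ (T t)) atTop (𝓝 1) := by
    have h1 := ((hℓsv _ hba).comp hWt).mul (hiii.comp hTt)
    rw [mul_one] at h1
    refine h1.congr' ?_
    filter_upwards [hZW, hWt.eventually_gt_atTop 0] with t ht hw
    simp only [Function.comp]
    rw [ht]
    exact div_mul_div_cancel₀ (hℓpos _ hw).ne'
  set M : ℝ → ℝ := fun y => -Real.log (p ⌊y ^ (β + 1)⌋₊) with hM
  have hMG : Tendsto (fun y => M y / (y * ℓ₀sharp y)) atTop (𝓝 1) := by
    refine (hi.comp (tendsto_rpow_atTop hb)).congr' ?_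
    filter_upwards [eventually_gt_atTop 0] with y hy
    simp only [Function.comp, hM]
    rw [← Real.rpow_mul hy.le, mul_comm (β + 1) a, hab, Real.rpow_one]
  have hMpos : ∀ᶠ x in atTop, 0 < M x := by
    filter_upwards [hMG.eventually (lt_mem_nhds zero_lt_one), eventually_gt_atTop 0] with x h1 h2
    have := hℓ₀sharppos x h2
    exact (div_pos_iff_of_pos_right (by positivity)).1 h1
  have hMrv : ∀ c > 0, Tendsto (fun x => M (c * x) / M x) atTop (𝓝 c) := by
    intro c hc
    have h1 := hMG.comp (tendsto_id.const_mul_atTop hc)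
    have h2 := ((h1.mul (hℓ₀sharpsv c hc)).mul (hMG.inv₀ one_ne_zero)).const_mul c
    simp only [inv_one, mul_one] at h2
    refine h2.congr' ?_
    filter_upwards [hMpos, eventually_gt_atTop 0] with x hx hx0
    have e1 := hℓ₀sharppos x hx0
    have e2 := hℓ₀sharppos (c * x) (by positivity)
    simp only [Function.comp, id]
    field_simp
  have hMmono : ∀ x ≥ (k₀ : ℝ) ^ a, ∀ x' ≥ x, M x ≤ M x' := by
    intro x hx x' hx'
    have h0 : (0:ℝ) ≤ (k₀ : ℝ) ^ a := by positivity
    have hx0 : 0 ≤ x := h0.trans hx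
    have h1 : (k₀ : ℝ) ≤ x ^ (β + 1) := by
      have := Real.rpow_le_rpow h0 hx hb.le
      rwa [← Real.rpow_mul (Nat.cast_nonneg _), hab, Real.rpow_one] at this
    have h2 : x ^ (β + 1) ≤ x' ^ (β + 1) := Real.rpow_le_rpow hx0 hx' hb.le
    have h3 : k₀ ≤ ⌊x ^ (β + 1)⌋₊ := Nat.le_floor h1
    have h4 : ⌊x ^ (β + 1)⌋₊ ≤ ⌊x' ^ (β + 1)⌋₊ := Nat.floor_mono h2
    exact neg_le_neg (Real.log_le_log (hppos _ (h3.trans h4)) (hmono _ _ h3 h4))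
  have hMy : Tendsto (fun t => M (y t) / T t) atTop (𝓝 1) := by
    have h1 := (Real.continuousAt_log one_ne_zero).tendsto.comp hC1
    rw [Real.log_one] at h1
    have h2 := (h1.div_atTop hTt).add_const 1
    rw [zero_add] at h2
    refine h2.congr' ?_
    filter_upwards [hTt.eventually_gt_atTop 0, eventually_gt_atTop 0] with t ht ht0
    have hpN := hppos _ (hNk t ht0)
    simp only [Function.comp, hM, hy]
    rw [← Real.rpow_mul (Nat.cast_nonneg _), hab, Real.rpow_one, Nat.floor_natCast,
      Real.log_div (by positivity) ht0.ne', one_div, Real.log_inv]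
    have : T t = Real.log t := rfl
    rw [← this]
    field_simp
    ring
  have hMZ : Tendsto (fun t => M (Z t) / T t) atTop (𝓝 1) := by
    have h1 := (hMG.comp hZt).mul (hconj.comp hTt)
    rw [mul_one] at h1
    refine h1.congr' ?_
    filter_upwards [hTt.eventually_gt_atTop 0, hZt.eventually_gt_atTop 0] with t ht hz
    have e1 := hℓ₀sharppos _ hz
    have e2 : (ℓ (T t) / (β + 1)) ^ a = Z t / T t := by
      simp only [hZ]; field_simp
    simp only [Function.comp]
    change M (Z t) / (Z t * ℓ₀sharp (Z t)) * ((ℓ (T t) / (β + 1)) ^ a * ℓ₀sharp (Z t)) = _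
    rw [e2]
    field_simp
  have hyZ : Tendsto (fun t => y t / Z t) atTop (𝓝 1) := by
    refine asymp_inj M _ hMmono hMpos hMrv y Z hyt hZt ?_
    have h1 := hMy.div hMZ one_ne_zero
    rw [div_one] at h1
    refine h1.congr' ?_
    filter_upwards [hTt.eventually_gt_atTop 0] with t ht
    exact div_div_div_cancel_right₀ ht.ne' _ _
  have hℓy := (hunif y Z hyt hZt hyZ).mul hℓZ
  rw [mul_one] at hℓy
  -- asymptotics of g (N t)
  have hgN : Tendsto (fun t => g (N t) / (T t ^ β * ℓ (T t))) atTop (𝓝 1) := by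
    have h1 := hgy.comp hyt
    have h2 := hyZ.rpow_const (p := β) (Or.inl one_ne_zero)
    have h3 := hℓy.rpow_const (p := a) (Or.inl one_ne_zero)
    rw [Real.one_rpow] at h2 h3
    have h4 := (h1.mul h2).mul h3
    simp only [mul_one] at h4
    refine h4.congr' ?_
    filter_upwards [hTt.eventually_gt_atTop 0, hZt.eventually_gt_atTop 0,
      hyt.eventually_gt_atTop 0] with t ht hz hy0
    have e1 := hℓpos _ ht
    have e2 := hℓpos _ hz
    have e3 := hℓpos _ hy0
    have e4 : y t ^ (β + 1) = N t := by
      simp only [hy]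
      rw [← Real.rpow_mul (Nat.cast_nonneg _), hab, Real.rpow_one]
    have e5 : Z t ^ β = T t ^ β * (ℓ (T t) ^ (a * β) / (β + 1) ^ (a * β)) := by
      simp only [hZ]
      rw [Real.mul_rpow ht.le (by positivity), ← Real.rpow_mul (by positivity),
        Real.div_rpow e1.le hb.le]
    have e6 : ℓ (T t) ^ (a * β) * ℓ (T t) ^ a = ℓ (T t) := by
      rw [← Real.rpow_add e1, show a * β + a = a * (β + 1) by ring, hab, Real.rpow_one]
    simp only [Function.comp]
    rw [e4, div_mul_div_cancel₀ e2.ne', Real.div_rpow hy0.le hz.le, Real.div_rpow e3.le e1.le, e5]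
    have e7 : T t ^ β * ℓ (T t) = T t ^ β * (ℓ (T t) ^ (a * β) * ℓ (T t) ^ a) := by rw [e6]
    rw [e7]
    have q1 : 0 < y t ^ β := by positivity
    have q2 : 0 < ℓ (y t) ^ a := by positivity
    have q3 : 0 < ℓ (T t) ^ a := by positivity
    have q4 : 0 < ℓ (T t) ^ (a * β) := by positivity
    have q5 : 0 < T t ^ β := by positivity
    have q6 : 0 < (β + 1) ^ (a * β) := by positivity
    generalize y t ^ β = r1 at *
    generalize ℓ (y t) ^ a = r2 at *
    generalize ℓ (T t) ^ a = r3 at *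
    generalize ℓ (T t) ^ (a * β) = r4 at *
    generalize T t ^ β = r5 at *
    generalize (β + 1) ^ (a * β) = r6 at *
    field_simp
  have hfin := (hC2 lam hlam).mul hgN
  rw [mul_one] at hfin
  refine hfin.congr' ?_
  filter_upwards [hgpos, hrho, (tendsto_id.const_mul_atTop hlam).eventually hrho] with t h1 h2 h3
  simp only [id] at h3
  rw [h2, h3, div_mul_div_cancel₀ h1.ne']
  congr 1
  ring
end
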